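/- arXiv:1602.02613 — 2 statements merged into one kernel-verified Lean document; each statement's English description precedes it below -/
import Mathlib

section
/- Let m ≥ 3 and let π ∈ S_m be a permutation which is both separating and irreducible. Let A = {λ ∈ Δ_m : T_{(π,λ)} has no n-th root in 𝔾 for any n ≥ 2}. Then A is a residual (comeagre) subset of Δ_m and its complement in Δ_m has Lebesgue measure zero. -/
open Set

namespace IETRoots

noncomputable section

/-- The unit interval `[0,1)`, the domain of our interval exchange transformations. -/
def unitI : Set ℝ := Set.Ico 0 1

/-- `T : ℝ → ℝ` is (the extension by the identity of) an interval exchange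
transformation: it fixes the complement of `[0,1)`, maps `[0,1)` bijectively onto
itself, and there is a finite partition of `[0,1)` into half-open intervals on each
of which `T` is a translation.  The group `𝔾` of IETs is the set of such maps under
composition. -/
def IsIET (T : ℝ → ℝ) : Prop :=
  Set.BijOn T unitI unitI ∧ (∀ x, x ∉ unitI → T x = x) ∧
  ∃ (k : ℕ) (β : Fin (k + 1) → ℝ), StrictMono β ∧ β 0 = 0 ∧ β (Fin.last k) = 1 ∧
    ∀ i : Fin k, ∃ c : ℝ, ∀ x ∈ Set.Ico (β i.castSucc) (β i.succ), T x = x + c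

/-- The `ℤ`-orbit `{T^n x : n ∈ ℤ}` of `x` under the bijection `T`. -/
def orbitZ (T : ℝ → ℝ) (x : ℝ) : Set ℝ := {y | ∃ n : ℕ, T^[n] x = y ∨ T^[n] y = x}

/-- `T` is minimal: every orbit is dense in `[0,1)`. -/
def IsMinimal (T : ℝ → ℝ) : Prop := ∀ x ∈ unitI, unitI ⊆ closure (orbitZ T x)

/-- `T` is of rotation type: `T x = x + α (mod 1)` on `[0,1)`. -/
def IsRotationType (T : ℝ → ℝ) : Prop := ∃ α : ℝ, ∀ x ∈ unitI, T x = Int.fract (x + α)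

/-- `T` has an `n`-th root in the group `𝔾` of IETs for some `n ≥ 2`. -/
def HasNontrivialRoot (T : ℝ → ℝ) : Prop :=
  ∃ (S : ℝ → ℝ) (n : ℕ), IsIET S ∧ 2 ≤ n ∧ S^[n] = T

/-- The set `D(T)` of points of `[0,1)` at which `T` is discontinuous
(as a map of `[0,1)`). -/
def DiscSet (T : ℝ → ℝ) : Set ℝ := {x | x ∈ unitI ∧ ¬ ContinuousWithinAt T unitI x}

/-- `β_j = λ_1 + ⋯ + λ_j` (`0`-indexed: the sum of the first `j` lengths). -/
def betaPt {m : ℕ} (lam : Fin m → ℝ) (j : ℕ) : ℝ :=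
  ∑ i ∈ Finset.univ.filter (fun i : Fin m => (i : ℕ) < j), lam i

/-- The interval exchange transformation `T_{(π,λ)}` determined by a permutation
`π ∈ S_m` and a length vector `λ`: on `I_j = [β_{j-1}, β_j)` it is given by
`x ↦ x - ∑_{i<j} λ_i + ∑_{π(i)<π(j)} λ_i`; outside `[0,1)` it is the identity. -/
noncomputable def ietMap {m : ℕ} (π : Equiv.Perm (Fin m)) (lam : Fin m → ℝ) : ℝ → ℝ :=
  fun x =>
    if h : ∃ j : Fin m, x ∈ Set.Ico (betaPt lam (j : ℕ)) (betaPt lam (j : ℕ) + lam j) then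
      x - betaPt lam (h.choose : ℕ) +
        ∑ i ∈ Finset.univ.filter (fun i : Fin m => π i < π h.choose), lam i
    else x

/-- A permutation `π ∈ S_m` is separating if `π(i+1) ≠ π(i) + 1` for `1 ≤ i ≤ m-1`. -/
def Separating {m : ℕ} (π : Equiv.Perm (Fin m)) : Prop :=
  ∀ i j : Fin m, (j : ℕ) = (i : ℕ) + 1 → (π j : ℕ) ≠ (π i : ℕ) + 1

/-- A permutation `π ∈ S_m` is irreducible if `π({1,…,k}) ≠ {1,…,k}` for all `k < m`. -/
def IrreduciblePerm {m : ℕ} (π : Equiv.Perm (Fin m)) : Prop :=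
  ∀ k : ℕ, 1 ≤ k → k < m → ∃ i : Fin m, (i : ℕ) < k ∧ k ≤ (π i : ℕ)

/-- The endpoints `0 = γ_0 < γ_1 < ⋯ < γ_{m-1} < γ_m = 1`, namely the discontinuities
of `T` together with `0` and `1`. -/
def endpointsOf (T : ℝ → ℝ) : Set ℝ := insert 0 (insert 1 (DiscSet T))

/-- The set of lengths `l_j = γ_j - γ_{j-1}` of the intervals of continuity of `T`,
i.e. the gaps between consecutive endpoints. -/
def gapLengths (T : ℝ → ℝ) : Set ℝ :=
  {l | ∃ a ∈ endpointsOf T, ∃ b ∈ endpointsOf T,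
        a < b ∧ (∀ c ∈ endpointsOf T, ¬(a < c ∧ c < b)) ∧ l = b - a}

/-- The rank of `T`: the dimension of the `ℚ`-vector space spanned by the lengths
`l_1, …, l_m`. -/
noncomputable def ietRank (T : ℝ → ℝ) : ℕ :=
  Module.finrank ℚ (Submodule.span ℚ (gapLengths T))

/-- Keane's infinite distinct orbit condition for an `m`-IET `T = T_{(π,λ)}`:
the orbits of `β_1, …, β_{m-1}` are infinite and pairwise disjoint. -/
def SatisfiesIDOC {m : ℕ} (lam : Fin m → ℝ) (T : ℝ → ℝ) : Prop :=
  (∀ j : ℕ, 1 ≤ j → j ≤ m - 1 → (orbitZ T (betaPt lam j)).Infinite) ∧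
  ∀ j j' : ℕ, 1 ≤ j → j ≤ m - 1 → 1 ≤ j' → j' ≤ m - 1 → j ≠ j' →
    orbitZ T (betaPt lam j) ∩ orbitZ T (betaPt lam j') = ∅

/-- A rotation: a `2`-IET with permutation `(21)`, i.e. `x ↦ x + α (mod 1)`
with `α ∈ (0,1)`. -/
def IsRotation (S : ℝ → ℝ) : Prop :=
  (∀ x, x ∉ unitI → S x = x) ∧ ∃ α ∈ Set.Ioo (0 : ℝ) 1, ∀ x ∈ unitI, S x = Int.fract (x + α)

/-- Conjugacy in the group `𝔾` of IETs. -/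
def IsConjugate (T T' : ℝ → ℝ) : Prop := ∃ g : ℝ → ℝ, IsIET g ∧ g ∘ T = T' ∘ g

/-- `T` is a tower of type `(n_1, …, n_k)` over the `k`-IET `S`:  there is a partition
`0 = t_0 < t_1 < ⋯ < t_k = 1` into intervals `I_i` on which `S` is a translation, a
scaling factor `c > 0`, and for each `i` a family of `n_i` pairwise disjoint "levels"
(scaled copies of `I_i`) which together partition `[0,1)`, such that `T` translates each
level of the `i`-th column onto the next one, and maps the top level back to the bottom
levels according to `S` (all after rescaling by `c`). -/
def IsTowerOver {k : ℕ} (T : ℝ → ℝ) (n : Fin k → ℕ) (S : ℝ → ℝ) : Prop :=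
  IsIET T ∧ IsIET S ∧ (∀ i, 0 < n i) ∧
  ∃ (t : Fin (k + 1) → ℝ) (c : ℝ) (a : Fin k → ℕ → ℝ),
    StrictMono t ∧ t 0 = 0 ∧ t (Fin.last k) = 1 ∧ 0 < c ∧
    (∀ i : Fin k, ∃ d : ℝ, ∀ x ∈ Set.Ico (t i.castSucc) (t i.succ), S x = x + d) ∧
    (∀ i : Fin k, ∀ j : ℕ, j < n i →
      Set.Ico (a i j) (a i j + c * (t i.succ - t i.castSucc)) ⊆ unitI) ∧
    (∀ i i' : Fin k, ∀ j j' : ℕ, j < n i → j' < n i' → (i, j) ≠ (i', j') →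
      Disjoint (Set.Ico (a i j) (a i j + c * (t i.succ - t i.castSucc)))
        (Set.Ico (a i' j') (a i' j' + c * (t i'.succ - t i'.castSucc)))) ∧
    (∀ y ∈ unitI, ∃ (i : Fin k) (j : ℕ), j < n i ∧
      y ∈ Set.Ico (a i j) (a i j + c * (t i.succ - t i.castSucc))) ∧
    (∀ i : Fin k, ∀ j : ℕ, j + 1 < n i → ∀ x ∈ Set.Ico (t i.castSucc) (t i.succ),
      T (a i j + c * (x - t i.castSucc)) = a i (j + 1) + c * (x - t i.castSucc)) ∧
    (∀ i : Fin k, ∀ x ∈ Set.Ico (t i.castSucc) (t i.succ), ∀ i' : Fin k,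
      S x ∈ Set.Ico (t i'.castSucc) (t i'.succ) →
      T (a i (n i - 1) + c * (x - t i.castSucc)) = a i' 0 + c * (S x - t i'.castSucc))

/-- The data of the first return map of `T` to `J = [a,b)`: a partition
`a = s_0 < s_1 < ⋯ < s_k = b` of `J`, return times `mt_i ≥ 1` and translation
constants `c_i` such that for `x` in the `i`-th piece the iterates `T^j x`, `0 < j < mt_i`,
avoid `J`, while `T^{mt_i} x = x + c_i ∈ J`.  Thus the first return map `T_J` is the
`k`-IET `x ↦ x + c_i` on the `i`-th piece. -/
def IsFirstReturnSystem (T : ℝ → ℝ) (a b : ℝ) {k : ℕ} (s : Fin (k + 1) → ℝ)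
    (mt : Fin k → ℕ) (c : Fin k → ℝ) : Prop :=
  StrictMono s ∧ s 0 = a ∧ s (Fin.last k) = b ∧
  ∀ i : Fin k, 0 < mt i ∧ ∀ x ∈ Set.Ico (s i.castSucc) (s i.succ),
    (∀ j : ℕ, 0 < j → j < mt i → T^[j] x ∉ Set.Ico a b) ∧
    T^[mt i] x ∈ Set.Ico a b ∧ T^[mt i] x = x + c i

/-- A finite sequence `x_0, …, x_k` is an `S`-chain if `x_0` and `x_k` lie in
`D(S) ∪ {0}` and `S x_i = x_{i+1}`. -/
def IsSChainSeq (S : ℝ → ℝ) {k : ℕ} (x : Fin (k + 1) → ℝ) : Prop :=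
  x 0 ∈ insert (0 : ℝ) (DiscSet S) ∧ x (Fin.last k) ∈ insert (0 : ℝ) (DiscSet S) ∧
  ∀ i : Fin k, S (x i.castSucc) = x i.succ

/-- A set `C ⊆ ℝ` is (the underlying set of) an `S`-chain. -/
def IsSChain (S : ℝ → ℝ) (C : Set ℝ) : Prop :=
  ∃ (k : ℕ) (x : Fin (k + 1) → ℝ), IsSChainSeq S x ∧ C = Set.range x

/-- A maximal `S`-chain: an `S`-chain which is not a proper subset of another `S`-chain. -/
def IsMaximalSChain (S : ℝ → ℝ) (C : Set ℝ) : Prop :=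
  IsSChain S C ∧ ∀ C', IsSChain S C' → C ⊆ C' → C = C'

/-- The open simplex `Δ_m ⊆ ℝ^m`. -/
def simplexSet (m : ℕ) : Set (Fin m → ℝ) := {lam | (∀ i, 0 < lam i) ∧ ∑ i, lam i = 1}

/-- The affine chart identifying (a superset of) `Δ_m` with a subset of `ℝ^{m-1}`:
`λ_i = x_i` for `i < m-1` and `λ_{m-1} = 1 - ∑ x_j`.  Lebesgue measure on `Δ_m`
is the `(m-1)`-dimensional Lebesgue measure carried through this chart. -/
def chartMap (m : ℕ) (x : Fin (m - 1) → ℝ) : Fin m → ℝ := fun i =>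
  if h : (i : ℕ) < m - 1 then x ⟨(i : ℕ), h⟩ else 1 - ∑ j, x j

/-- The permutation `(321) ∈ S_3`, sending `1 ↦ 3`, `2 ↦ 2`, `3 ↦ 1`. -/
def perm321 : Equiv.Perm (Fin 3) :=
  ⟨fun i => i.rev, fun i => i.rev, fun i => Fin.rev_rev i, fun i => Fin.rev_rev i⟩

end


/-! ### Germs of piecewise translations -/

open Filter Topology

lemma perm_apply_inv (S : Equiv.Perm ℝ) (x : ℝ) : S (S⁻¹ x) = x := Equiv.apply_symm_apply S x

lemma perm_inv_apply (S : Equiv.Perm ℝ) (x : ℝ) : S⁻¹ (S x) = x := Equiv.symm_apply_apply S x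

/-- `S` is right-continuous and locally a translation to the right of every point. -/
def RC (S : Equiv.Perm ℝ) : Prop := ∀ x, ∀ᶠ y in 𝓝[>] x, S y = y + (S x - x)

/-- `S` sends the left germ at `x` to the left germ at `x'`. -/
def LG (S : Equiv.Perm ℝ) (x x' : ℝ) : Prop := ∀ᶠ y in 𝓝[<] x, S y = y + (x' - x)

lemma tendsto_add_left_germ (x x' : ℝ) :
    Tendsto (fun y => y + (x' - x)) (𝓝[<] x) (𝓝[<] x') := by
  apply tendsto_nhdsWithin_of_tendsto_nhds_of_eventually_within
  · have : Tendsto (fun y : ℝ => y + (x' - x)) (𝓝 x) (𝓝 (x + (x' - x))) :=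
      (continuous_id.add continuous_const).tendsto x
    rw [add_sub_cancel] at this
    exact this.mono_left nhdsWithin_le_nhds
  · filter_upwards [self_mem_nhdsWithin] with y hy
    simp only [Set.mem_Iio] at *
    linarith

lemma tendsto_add_right_germ (x x' : ℝ) :
    Tendsto (fun y => y + (x' - x)) (𝓝[>] x) (𝓝[>] x') := by
  apply tendsto_nhdsWithin_of_tendsto_nhds_of_eventually_within
  · have : Tendsto (fun y : ℝ => y + (x' - x)) (𝓝 x) (𝓝 (x + (x' - x))) :=
      (continuous_id.add continuous_const).tendsto x
    rw [add_sub_cancel] at this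
    exact this.mono_left nhdsWithin_le_nhds
  · filter_upwards [self_mem_nhdsWithin] with y hy
    simp only [Set.mem_Ioi] at *
    linarith

lemma LG.tendsto {S : Equiv.Perm ℝ} {x x' : ℝ} (h : LG S x x') :
    Tendsto S (𝓝[<] x) (𝓝[<] x') :=
  (tendsto_add_left_germ x x').congr' (h.mono fun _ hy => hy.symm)

lemma RC.tendsto {S : Equiv.Perm ℝ} (h : RC S) (x : ℝ) :
    Tendsto S (𝓝[>] x) (𝓝[>] (S x)) :=
  (tendsto_add_right_germ x (S x)).congr' ((h x).mono fun _ hy => hy.symm)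

lemma LG.comp {S R : Equiv.Perm ℝ} {x x' x'' : ℝ} (h : LG S x x') (h' : LG R x' x'') :
    LG (R * S) x x'' := by
  filter_upwards [h, h.tendsto.eventually h'] with y hy hy'
  rw [Equiv.Perm.mul_apply, hy', hy]; ring

lemma LG.inv {S : Equiv.Perm ℝ} {x x' : ℝ} (h : LG S x x') : LG S⁻¹ x' x := by
  have := (tendsto_add_left_germ x' x).eventually h
  filter_upwards [this] with y hy
  rw [Equiv.Perm.inv_eq_iff_eq, hy]; ring

lemma LG.unique {S : Equiv.Perm ℝ} {x x' x'' : ℝ} (h : LG S x x') (h' : LG S x x'') :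
    x' = x'' := by
  obtain ⟨y, hy, hy'⟩ := (h.and h').exists
  rw [hy] at hy'; linarith

lemma LG.one (x : ℝ) : LG 1 x x := by
  unfold LG; simp

lemma LG.pow_of {T : Equiv.Perm ℝ} {x : ℝ} (k : ℕ)
    (h : ∀ l < k, LG T ((T ^ l) x) (T ((T ^ l) x))) : LG (T ^ k) x ((T ^ k) x) := by
  induction k with
  | zero => simpa using LG.one x
  | succ k ih =>
    have h1 := ih fun l hl => h l (by omega)
    have := h1.comp (h k (by omega))
    rwa [← pow_succ', ← Equiv.Perm.mul_apply, ← pow_succ'] at this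

lemma RC.one : RC 1 := by intro x; simp

lemma RC.mul {R S : Equiv.Perm ℝ} (hR : RC R) (hS : RC S) : RC (R * S) := by
  intro x
  filter_upwards [hS x, (hS.tendsto x).eventually (hR (S x))] with y hy hy'
  rw [Equiv.Perm.mul_apply, Equiv.Perm.mul_apply, hy', hy]; ring

lemma RC.inv {S : Equiv.Perm ℝ} (hS : RC S) : RC S⁻¹ := by
  intro x
  have := (tendsto_add_right_germ x (S⁻¹ x)).eventually (hS (S⁻¹ x))
  filter_upwards [this] with y hy
  rw [Equiv.Perm.inv_eq_iff_eq, hy, perm_apply_inv]; ring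

lemma RC.pow {S : Equiv.Perm ℝ} (hS : RC S) (k : ℕ) : RC (S ^ k) := by
  induction k with
  | zero => simpa using RC.one
  | succ k ih => rw [pow_succ]; exact ih.mul hS

lemma RC.zpow {S : Equiv.Perm ℝ} (hS : RC S) (k : ℤ) : RC (S ^ k) := by
  cases k with
  | ofNat k => simpa using hS.pow k
  | negSucc k => rw [zpow_negSucc]; exact (hS.pow _).inv

/-- Points where the left germ is not sent to the left germ of the image. -/
def DS (S : Equiv.Perm ℝ) : Set ℝ := {x | ¬ LG S x (S x)}

lemma DS.mul_finite {R S : Equiv.Perm ℝ} (hR : (DS R).Finite) (hS : (DS S).Finite) :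
    (DS (R * S)).Finite := by
  refine (hS.union (hR.preimage (S.injective.injOn))).subset ?_
  intro x hx
  by_contra hc
  simp only [DS, Set.mem_union, Set.mem_ofPred_eq, Set.mem_preimage, not_or, not_not] at hc
  exact hx (hc.1.comp hc.2)

lemma DS.inv_finite {S : Equiv.Perm ℝ} (hS : (DS S).Finite) : (DS S⁻¹).Finite := by
  refine (hS.preimage ((S⁻¹).injective.injOn)).subset ?_
  intro x hx
  by_contra hc
  simp only [DS, Set.mem_ofPred_eq, Set.mem_preimage, not_not, perm_apply_inv] at hc
  exact hx hc.inv

lemma DS.pow_finite {S : Equiv.Perm ℝ} (hS : (DS S).Finite) (k : ℕ) : (DS (S ^ k)).Finite := by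
  induction k with
  | zero =>
    have : DS (S ^ 0) = ∅ := by
      ext x; simpa [DS] using LG.one x
    rw [this]; exact Set.finite_empty
  | succ k ih => rw [pow_succ]; exact DS.mul_finite ih hS

lemma DS.zpow_finite {S : Equiv.Perm ℝ} (hS : (DS S).Finite) (k : ℤ) : (DS (S ^ k)).Finite := by
  cases k with
  | ofNat k => simpa using DS.pow_finite hS k
  | negSucc k => rw [zpow_negSucc]; exact DS.inv_finite (DS.pow_finite hS _)

/-- A function that is locally constant from the right and from the left is constant. -/
lemma const_of_germs {α : Type*} (f : ℝ → α) {a b : ℝ} (hab : a ≤ b)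
    (hr : ∀ x ∈ Ico a b, ∀ᶠ y in 𝓝[>] x, f y = f x)
    (hl : ∀ x ∈ Ioc a b, ∀ᶠ y in 𝓝[<] x, f y = f x) : f b = f a := by
  let _ : TopologicalSpace α := ⊥
  have _ : DiscreteTopology α := ⟨rfl⟩
  have hc : ContinuousOn f (Icc a b) := by
    intro x hx
    have h1 : ∀ᶠ y in 𝓝[Icc a b] x, f y = f x := by
      rw [eventually_nhdsWithin_iff]
      have hL : ∀ᶠ y in 𝓝[<] x, y ∈ Icc a b → f y = f x := by
        rcases eq_or_lt_of_le hx.1 with h | h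
        · filter_upwards [self_mem_nhdsWithin] with y hy hy'
          exact absurd hy'.1 (by simp only [Set.mem_Iio] at hy; linarith)
        · exact (hl x ⟨h, hx.2⟩).mono fun _ hy _ => hy
      have hR : ∀ᶠ y in 𝓝[>] x, y ∈ Icc a b → f y = f x := by
        rcases eq_or_lt_of_le hx.2 with h | h
        · filter_upwards [self_mem_nhdsWithin] with y hy hy'
          exact absurd hy'.2 (by simp only [Set.mem_Ioi] at hy; linarith)
        · exact (hr x ⟨hx.1, h⟩).mono fun _ hy _ => hy
      rw [eventually_nhdsWithin_iff] at hL hR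
      filter_upwards [hL, hR] with y hy1 hy2
      rcases lt_trichotomy y x with h | h | h
      · exact hy1 h
      · intro _; rw [h]
      · exact hy2 h
    exact tendsto_nhds_of_eventually_eq h1
  exact isPreconnected_Icc.constant hc (right_mem_Icc.2 hab) (left_mem_Icc.2 hab)

/-! ### Systems without connections -/

structure Sys (T : Equiv.Perm ℝ) (B : Set ℝ) : Prop where
  fin : B.Finite
  sub : B ⊆ Ico 0 1
  zero : (0 : ℝ) ∈ B
  maps : ∀ x, T x ∈ Ico (0 : ℝ) 1 ↔ x ∈ Ico (0 : ℝ) 1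
  rc : RC T
  lg : ∀ x ∈ Ico (0 : ℝ) 1, x ∉ B → LG T x (T x)
  conn : ∀ k : ℕ, 1 ≤ k → ∀ b ∈ B, ∀ b' ∈ B, (T ^ k) b = b' → k = 1 ∧ b' = 0 ∧ b ≠ 0

lemma maps_pow {T : Equiv.Perm ℝ} (h : ∀ x, T x ∈ Ico (0 : ℝ) 1 ↔ x ∈ Ico (0 : ℝ) 1)
    (k : ℕ) (x : ℝ) : (T ^ k) x ∈ Ico (0 : ℝ) 1 ↔ x ∈ Ico (0 : ℝ) 1 := by
  induction k with
  | zero => simp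
  | succ k ih => rw [pow_succ', Equiv.Perm.mul_apply, h, ih]

lemma maps_zpow {T : Equiv.Perm ℝ} (h : ∀ x, T x ∈ Ico (0 : ℝ) 1 ↔ x ∈ Ico (0 : ℝ) 1)
    (k : ℤ) (x : ℝ) : (T ^ k) x ∈ Ico (0 : ℝ) 1 ↔ x ∈ Ico (0 : ℝ) 1 := by
  cases k with
  | ofNat k => simpa using maps_pow h k x
  | negSucc k =>
    rw [zpow_negSucc, ← maps_pow h (k + 1), perm_apply_inv]

namespace Sys

variable {T : Equiv.Perm ℝ} {B : Set ℝ}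

lemma aperiodic (h : Sys T B) {p : ℕ} (hp : 1 ≤ p) {x : ℝ} (hx : x ∈ Ico (0 : ℝ) 1) :
    (T ^ p) x ≠ x := by
  intro hpx
  set A : Set ℝ := Icc 0 x ∩ ⋃ l ∈ Finset.range p, (T ^ l : Equiv.Perm ℝ) ⁻¹' B with hA
  have hAf : A.Finite := by
    refine Set.Finite.subset (s := ⋃ l ∈ Finset.range p, (T ^ l : Equiv.Perm ℝ) ⁻¹' B) ?_
      Set.inter_subset_right
    exact Set.Finite.biUnion (Finset.finite_toSet _)
      fun l _ => h.fin.preimage ((T ^ l).injective.injOn)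
  have h0A : (0 : ℝ) ∈ A := by
    refine ⟨⟨le_rfl, hx.1⟩, ?_⟩
    simp only [Set.mem_iUnion]
    exact ⟨0, Finset.mem_range.2 (by omega), by simpa using h.zero⟩
  obtain ⟨y, hyA, hymax⟩ := Set.exists_max_image A id hAf ⟨0, h0A⟩
  have hy1 : y ≤ x := hyA.1.2
  have hy0 : 0 ≤ y := hyA.1.1
  have hyp : (T ^ p) y = y := by
    have := const_of_germs (fun z => (T ^ p) z - z) hy1 ?_ ?_
    · simp only [hpx] at this; linarith
    · intro z _
      filter_upwards [(h.rc.pow p) z] with w hw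
      rw [hw]; ring
    · intro z hz
      have hzl : LG (T ^ p) z ((T ^ p) z) := by
        apply LG.pow_of
        intro l hl
        apply h.lg
        · exact (maps_pow h.maps l z).2 ⟨hy0.trans hz.1.le, lt_of_le_of_lt hz.2 hx.2⟩
        · intro hB
          have : z ∈ A := by
            refine ⟨⟨hy0.trans hz.1.le, hz.2⟩, ?_⟩
            simp only [Set.mem_iUnion]
            exact ⟨l, Finset.mem_range.2 hl, hB⟩
          exact absurd (hymax z this) (not_le.2 hz.1)
      filter_upwards [hzl] with w hw
      rw [hw]; ring
  have := hyA.2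
  simp only [Set.mem_iUnion] at this
  obtain ⟨l, _, hl⟩ := this
  have h2 := h.conn p hp _ hl _ hl (by
    rw [← Equiv.Perm.mul_apply, ← pow_add, add_comm, pow_add, Equiv.Perm.mul_apply, hyp])
  exact h2.2.2 h2.2.1

lemma zpow_inj (h : Sys T B) {x : ℝ} (hx : x ∈ Ico (0 : ℝ) 1) :
    Function.Injective fun k : ℤ => (T ^ k) x := by
  have key : ∀ a b : ℤ, a < b → (T ^ a) x ≠ (T ^ b) x := by
    intro a b hab heq
    obtain ⟨p, hp⟩ : ∃ p : ℕ, b - a = p := ⟨(b - a).toNat, by omega⟩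
    have hb : b = p + a := by omega
    rw [hb, zpow_add, Equiv.Perm.mul_apply, zpow_natCast] at heq
    exact h.aperiodic (by omega) ((maps_zpow h.maps a x).2 hx) heq.symm
  intro a b hab
  rcases lt_trichotomy a b with h1 | h1 | h1
  · exact absurd hab (key _ _ h1)
  · exact h1
  · exact absurd hab.symm (key _ _ h1)

/-- Far in the past and in the future, orbits avoid finite sets. -/
lemma exists_pos_avoid (h : Sys T B) {x : ℝ} (hx : x ∈ Ico (0 : ℝ) 1) {F : Set ℝ}
    (hF : F.Finite) (M : ℕ) : ∃ k : ℕ, M ≤ k ∧ (T ^ k) x ∉ F := by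
  by_contra hc
  push Not at hc
  have hinj : Function.Injective fun k : ℕ => (T ^ (M + k)) x := by
    intro a b hab
    have := h.zpow_inj hx (a₁ := ((M + a : ℕ) : ℤ)) (a₂ := ((M + b : ℕ) : ℤ))
      (by simpa only [zpow_natCast] using hab)
    omega
  exact Set.infinite_of_injective_forall_mem hinj (fun k => hc (M + k) (by omega)) hF

lemma exists_neg_avoid (h : Sys T B) {x : ℝ} (hx : x ∈ Ico (0 : ℝ) 1) {F : Set ℝ}
    (hF : F.Finite) : ∃ k : ℕ, ((T ^ k)⁻¹) x ∉ F := by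
  by_contra hc
  push Not at hc
  have hinj : Function.Injective fun k : ℕ => ((T ^ k)⁻¹) x := by
    intro a b hab
    have := h.zpow_inj hx (a₁ := -(a : ℤ)) (a₂ := -(b : ℤ))
      (by simpa only [zpow_natCast, zpow_neg] using hab)
    omega
  exact Set.infinite_of_injective_forall_mem hinj (fun k => hc k) hF

/-- Invariant step functions are constant. -/
lemma invariant_const (h : Sys T B) {α : Type*} (f : ℝ → α)
    (hr : ∀ x ∈ Ico (0 : ℝ) 1, ∀ᶠ y in 𝓝[>] x, f y = f x)
    (hfin : {x | x ∈ Ioo (0 : ℝ) 1 ∧ ¬ ∀ᶠ y in 𝓝[<] x, f y = f x}.Finite)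
    (hinv : ∀ x ∈ Ico (0 : ℝ) 1, f (T x) = f x) :
    ∀ x ∈ Ico (0 : ℝ) 1, f x = f 0 := by
  set Γ := {x | x ∈ Ioo (0 : ℝ) 1 ∧ ¬ ∀ᶠ y in 𝓝[<] x, f y = f x} with hΓ
  have hIco : ∀ x ∈ Ioo (0 : ℝ) 1, ∀ᶠ y in 𝓝[<] x, y ∈ Ico (0 : ℝ) 1 := by
    intro x hx
    filter_upwards [Ioo_mem_nhdsLT hx.1] with y hy
    exact ⟨hy.1.le, hy.2.trans hx.2⟩
  have hmem : ∀ x ∈ Ico (0 : ℝ) 1, x ∉ B → x ∈ Ioo (0 : ℝ) 1 := by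
    intro x hx hxB
    refine ⟨lt_of_le_of_ne hx.1 ?_, hx.2⟩
    rintro rfl
    exact hxB h.zero
  have hΓe : Γ = ∅ := by
    by_contra hne
    obtain ⟨g, hg⟩ := Set.nonempty_iff_ne_empty.2 hne
    have hgI : g ∈ Ico (0 : ℝ) 1 := ⟨hg.1.1.le, hg.1.2⟩
    have hfor : ∃ k : ℕ, (T ^ k) g ∈ B := by
      by_contra hc
      push Not at hc
      have : ∀ k : ℕ, (T ^ k) g ∈ Γ := by
        intro k
        induction k with
        | zero => simpa using hg
        | succ k ih =>
          have hkI := (maps_pow h.maps k g).2 hgI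
          have hl := h.lg _ hkI (hc k)
          rw [pow_succ', Equiv.Perm.mul_apply]
          refine ⟨hmem _ ((h.maps _).2 hkI) ?_, ?_⟩
          · have := hc (k + 1)
            rwa [pow_succ', Equiv.Perm.mul_apply] at this
          · intro hev
            apply ih.2
            filter_upwards [hl.tendsto.eventually hev, hIco _ ih.1] with y hy hy'
            rw [hinv _ hy', hinv _ hkI] at hy
            exact hy
      obtain ⟨k, _, hk⟩ := h.exists_pos_avoid hgI hfin 0
      exact hk (this k)
    have hback : ∃ l : ℕ, ((T ^ (l + 1))⁻¹) g ∈ B := by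
      by_contra hc
      push Not at hc
      have : ∀ k : ℕ, ((T ^ k)⁻¹) g ∈ Γ := by
        intro k
        induction k with
        | zero => simpa using hg
        | succ k ih =>
          set w := ((T ^ (k + 1))⁻¹) g with hw
          have hTw : T w = ((T ^ k)⁻¹) g := by
            rw [hw, Equiv.Perm.eq_inv_iff_eq, ← Equiv.Perm.mul_apply, ← pow_succ,
              perm_apply_inv]
          rw [← hTw] at ih
          have hwI : w ∈ Ico (0 : ℝ) 1 := (h.maps w).1 ⟨ih.1.1.le, ih.1.2⟩
          have hl := h.lg _ hwI (hc k)
          refine ⟨hmem _ hwI (hc k), ?_⟩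
          intro hev
          apply ih.2
          filter_upwards [hl.inv.tendsto.eventually hev, hIco _ ih.1] with y hy hy'
          have h1 := hinv (T⁻¹ y) ((h.maps _).1 (by rwa [perm_apply_inv]))
          rw [perm_apply_inv] at h1
          rw [h1, hinv _ hwI]
          exact hy
      obtain ⟨k, hk⟩ := h.exists_neg_avoid hgI hfin
      exact hk (this k)
    obtain ⟨k, hk⟩ := hfor
    obtain ⟨l, hl⟩ := hback
    have := h.conn (k + (l + 1)) (by omega) _ hl _ hk (by
      rw [pow_add, Equiv.Perm.mul_apply, perm_apply_inv])
    have hk0 : k = 0 := by omega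
    have h0 := this.2.1
    rw [hk0] at h0
    exact hg.1.1.ne' (by simpa using h0)
  intro x hx
  refine const_of_germs f hx.1 (fun y hy => hr y ⟨hy.1, hy.2.trans hx.2⟩) ?_
  intro y hy
  by_contra hc
  have : y ∈ Γ := ⟨⟨hy.1, lt_of_le_of_lt hy.2 hx.2⟩, hc⟩
  rw [hΓe] at this
  exact this

end Sys

/-! ### Step functions and the rank inequality -/

/-- The largest element of `P` below `x` (or `0`). -/
noncomputable def flv (P : Finset ℝ) (x : ℝ) : ℝ :=
  (insert 0 (P.filter (· ≤ x))).max' (Finset.insert_nonempty _ _)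

lemma flv_mono (P : Finset ℝ) : Monotone (flv P) := by
  intro x y hxy
  apply Finset.max'_subset
  apply Finset.insert_subset_insert
  intro q hq
  rw [Finset.mem_filter] at *
  exact ⟨hq.1, hq.2.trans hxy⟩

lemma flv_mem {P : Finset ℝ} (h0 : (0 : ℝ) ∈ P) (x : ℝ) : flv P x ∈ P := by
  have := Finset.max'_mem (insert 0 (P.filter (· ≤ x))) (Finset.insert_nonempty _ _)
  rw [Finset.mem_insert] at this
  rcases this with h | h
  · unfold flv; rw [h]; exact h0
  · exact (Finset.mem_filter.1 h).1

lemma flv_le {P : Finset ℝ} {x : ℝ} (hx : 0 ≤ x) : flv P x ≤ x := by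
  have := Finset.max'_mem (insert 0 (P.filter (· ≤ x))) (Finset.insert_nonempty _ _)
  rw [Finset.mem_insert] at this
  rcases this with h | h
  · unfold flv; rw [h]; exact hx
  · exact (Finset.mem_filter.1 h).2

lemma le_flv {P : Finset ℝ} {x q : ℝ} (hq : q ∈ P) (hqx : q ≤ x) : q ≤ flv P x :=
  Finset.le_max' _ _ (Finset.mem_insert_of_mem (Finset.mem_filter.2 ⟨hq, hqx⟩))

lemma flv_self {P : Finset ℝ} {x : ℝ} (hx : 0 ≤ x) (hq : x ∈ P) : flv P x = x :=
  le_antisymm (flv_le hx) (le_flv hq le_rfl)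

lemma flv_congr {P : Finset ℝ} {x y : ℝ} (h : ∀ q ∈ P, q ≤ y ↔ q ≤ x) : flv P y = flv P x := by
  unfold flv
  congr 2
  exact Finset.filter_congr h

lemma flv_right (P : Finset ℝ) (x : ℝ) : ∀ᶠ y in 𝓝[>] x, flv P y = flv P x := by
  have : ∀ᶠ y in 𝓝[>] x, ∀ q ∈ P, q ≤ y ↔ q ≤ x := by
    rw [Filter.eventually_all_finset]
    intro q _
    rcases le_or_gt q x with h | h
    · filter_upwards [self_mem_nhdsWithin] with y hy
      simp only [Set.mem_Ioi] at hy
      exact ⟨fun _ => h, fun _ => h.trans hy.le⟩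
    · filter_upwards [Ioo_mem_nhdsGT h] with y hy
      exact ⟨fun h' => absurd hy.2 (not_lt.2 h'), fun h' => absurd h (not_lt.2 h')⟩
  exact this.mono fun y hy => flv_congr hy

lemma flv_left {P : Finset ℝ} {x : ℝ} (hx : x ∉ P) : ∀ᶠ y in 𝓝[<] x, flv P y = flv P x := by
  have : ∀ᶠ y in 𝓝[<] x, ∀ q ∈ P, q ≤ y ↔ q ≤ x := by
    rw [Filter.eventually_all_finset]
    intro q hq
    have hne : q ≠ x := fun h => hx (h ▸ hq)
    rcases lt_or_gt_of_ne hne with h | h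
    · filter_upwards [Ioo_mem_nhdsLT h] with y hy
      exact ⟨fun _ => h.le, fun _ => hy.1.le⟩
    · filter_upwards [self_mem_nhdsWithin] with y hy
      simp only [Set.mem_Iio] at hy
      exact ⟨fun h' => by linarith, fun h' => by linarith⟩
  exact this.mono fun y hy => flv_congr hy

lemma step_flv {α : Type*} {P : Finset ℝ} (h0 : (0 : ℝ) ∈ P) (hP : ∀ p ∈ P, 0 ≤ p) (f : ℝ → α)
    (hr : ∀ x ∈ Ico (0 : ℝ) 1, ∀ᶠ y in 𝓝[>] x, f y = f x)
    (hl : ∀ x ∈ Ioo (0 : ℝ) 1, x ∉ P → ∀ᶠ y in 𝓝[<] x, f y = f x)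
    {x : ℝ} (hx : x ∈ Ico (0 : ℝ) 1) : f x = f (flv P x) := by
  have hf0 := hP _ (flv_mem h0 x)
  refine const_of_germs f (flv_le hx.1) ?_ ?_
  · intro y hy
    exact hr y ⟨hf0.trans hy.1, hy.2.trans hx.2⟩
  · intro y hy
    refine hl y ⟨lt_of_le_of_lt hf0 hy.1, lt_of_le_of_lt hy.2 hx.2⟩ ?_
    intro hyP
    exact absurd (le_flv hyP hy.2) (not_le.2 hy.1)

/-- The floor map with values in the finite set. -/
noncomputable def fl {P : Finset ℝ} (h0 : (0 : ℝ) ∈ P) (x : ℝ) : P := ⟨flv P x, flv_mem h0 x⟩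

lemma fl_measurable {P : Finset ℝ} (h0 : (0 : ℝ) ∈ P) : Measurable (fl h0) :=
  (flv_mono P).measurable.subtype_mk

open MeasureTheory

lemma integrable_fl {P : Finset ℝ} (h0 : (0 : ℝ) ∈ P) (g : P → ℝ) :
    Integrable (fun x => g (fl h0 x)) (volume.restrict (Ico (0 : ℝ) 1)) := by
  have hg : Measurable g := measurable_of_finite g
  refine Integrable.of_bound (hg.comp (fl_measurable h0)).aestronglyMeasurable (∑ p, ‖g p‖) ?_
  refine Filter.Eventually.of_forall fun x => ?_
  exact Finset.single_le_sum (f := fun p => ‖g p‖) (fun _ _ => norm_nonneg _) (Finset.mem_univ _)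

/-- Integration of rational step functions. -/
noncomputable def intP {P : Finset ℝ} (h0 : (0 : ℝ) ∈ P) : (P → ℚ) →ₗ[ℚ] ℝ where
  toFun g := ∫ x in Ico (0 : ℝ) 1, ((g (fl h0 x) : ℚ) : ℝ)
  map_add' g g' := by
    simp only [Pi.add_apply, Rat.cast_add]
    exact integral_add (integrable_fl h0 fun p => (g p : ℝ)) (integrable_fl h0 fun p => (g' p : ℝ))
  map_smul' c g := by
    simp only [Pi.smul_apply, smul_eq_mul, Rat.cast_mul, RingHom.id_apply]
    rw [integral_const_mul, Rat.smul_def]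

lemma integral_comp_piecewise {S : Equiv.Perm ℝ} {Q : Finset ℝ}
    (h0 : (0 : ℝ) ∈ Q) (hrc : RC S) (hmaps : ∀ x, S x ∈ Ico (0 : ℝ) 1 ↔ x ∈ Ico (0 : ℝ) 1)
    (hlg : ∀ x ∈ Ico (0 : ℝ) 1, x ∉ Q → LG S x (S x)) (g : ℝ → ℝ) :
    ∫ x in Ico (0 : ℝ) 1, g (S x) = ∫ x in Ico (0 : ℝ) 1, g x := by
  set s : Set ℝ := Ico (0 : ℝ) 1 \ (Q : Set ℝ) with hs
  have hms : MeasurableSet s := measurableSet_Ico.diff Q.finite_toSet.measurableSet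
  have hder : ∀ x ∈ s, HasDerivWithinAt S ((fun _ => (1 : ℝ)) x) s x := by
    intro x hx
    apply HasDerivAt.hasDerivWithinAt
    have h1 : HasDerivAt (fun y : ℝ => y + (S x - x)) 1 x := (hasDerivAt_id x).add_const _
    refine h1.congr_of_eventuallyEq ?_
    have hL := hlg x hx.1 hx.2
    have hR := hrc x
    unfold LG at hL
    rw [eventually_nhdsWithin_iff] at hL hR
    filter_upwards [hL, hR] with y hy1 hy2
    rcases lt_trichotomy y x with h | h | h
    · exact hy1 h
    · rw [h]; ring
    · exact hy2 h
  have key := integral_image_eq_integral_abs_deriv_smul hms hder S.injective.injOn g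
  have himg : S '' s = Ico (0 : ℝ) 1 \ S '' (Q : Set ℝ) := by
    rw [hs, Set.image_sdiff S.injective]
    congr 1
    ext y
    constructor
    · rintro ⟨x, hx, rfl⟩; exact (hmaps x).2 hx
    · intro hy
      exact ⟨S⁻¹ y, (hmaps _).1 (by rwa [perm_apply_inv]), perm_apply_inv S y⟩
  have hnull : ∀ F : Set ℝ, F.Finite → (Ico (0 : ℝ) 1 \ F : Set ℝ) =ᵐ[volume] Ico (0 : ℝ) 1 := by
    intro F hF
    exact sdiff_null_ae_eq_self (hF.measure_zero _)
  rw [himg, setIntegral_congr_set (hnull _ (Q.finite_toSet.image _)), hs,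
    setIntegral_congr_set (hnull _ Q.finite_toSet)] at key
  simpa using key.symm

/-- The rank inequality. -/
lemma rank_ineq {S : Equiv.Perm ℝ} {P Q : Finset ℝ}
    (h0 : (0 : ℝ) ∈ Q) (hQP : Q ⊆ P) (hP : ∀ p ∈ P, p ∈ Ico (0 : ℝ) 1)
    (hrc : RC S) (hmaps : ∀ x, S x ∈ Ico (0 : ℝ) 1 ↔ x ∈ Ico (0 : ℝ) 1)
    (hlg : ∀ x ∈ Ico (0 : ℝ) 1, x ∉ Q → LG S x (S x))
    (hSQ : ∀ x, S x ∈ Q → x ∈ P)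
    (hconst : ∀ f : ℝ → ℚ, (∀ x ∈ Ico (0 : ℝ) 1, ∀ᶠ y in 𝓝[>] x, f y = f x) →
      {x | x ∈ Ioo (0 : ℝ) 1 ∧ ¬ ∀ᶠ y in 𝓝[<] x, f y = f x}.Finite →
      (∀ x ∈ Ico (0 : ℝ) 1, f (S x) = f x) → ∀ x ∈ Ico (0 : ℝ) 1, f x = f 0)
    {m : ℕ} (lam : Fin m → ℝ) (hli : LinearIndependent ℚ lam)
    (hlam : ∀ a, ∃ u ∈ P, ∃ v ∈ insert 1 P, u ≤ v ∧ lam a = v - u) :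
    m + Q.card ≤ P.card + 1 := by
  have h0P := hQP h0
  have hP0 : ∀ p ∈ P, 0 ≤ p := fun p hp => (hP p hp).1
  let Φ : (Q → ℚ) →ₗ[ℚ] (P → ℚ) :=
    { toFun := fun g p => g (fl h0 p) - g (fl h0 (S p))
      map_add' := fun g g' => by ext p; simp; ring
      map_smul' := fun c g => by ext p; simp; ring }
  have hext : ∀ g : Q → ℚ, ∀ x ∈ Ico (0 : ℝ) 1,
      Φ g (fl h0P x) = g (fl h0 x) - g (fl h0 (S x)) := by
    intro g x hx
    refine (step_flv h0P hP0 (fun x => g (fl h0 x) - g (fl h0 (S x))) ?_ ?_ hx).symm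
    · intro y hy
      filter_upwards [flv_right Q y, (hrc.tendsto y).eventually (flv_right Q (S y))] with z hz hz'
      have e1 : fl h0 z = fl h0 y := Subtype.ext hz
      have e2 : fl h0 (S z) = fl h0 (S y) := Subtype.ext hz'
      rw [e1, e2]
    · intro y hy hyP
      have hyQ : y ∉ Q := fun h => hyP (hQP h)
      have hSy : S y ∉ Q := fun h => hyP (hSQ y h)
      have hL := hlg y ⟨hy.1.le, hy.2⟩ hyQ
      filter_upwards [flv_left hyQ, hL.tendsto.eventually (flv_left hSy)] with z hz hz'
      have e1 : fl h0 z = fl h0 y := Subtype.ext hz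
      have e2 : fl h0 (S z) = fl h0 (S y) := Subtype.ext hz'
      rw [e1, e2]
  have hIΦ : ∀ g, intP h0P (Φ g) = 0 := by
    intro g
    have e1 : intP h0P (Φ g) = ∫ x in Ico (0 : ℝ) 1, ((g (fl h0 x) : ℝ) - (g (fl h0 (S x)) : ℝ)) := by
      change (∫ x in Ico (0 : ℝ) 1, ((Φ g (fl h0P x) : ℚ) : ℝ)) = _
      refine setIntegral_congr_fun measurableSet_Ico fun x hx => ?_
      simp only [hext g x hx, Rat.cast_sub]
    have i1 := integrable_fl h0 fun p => (g p : ℝ)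
    have i2 : Integrable (fun x => (g (fl h0 (S x)) : ℝ)) (volume.restrict (Ico (0 : ℝ) 1)) := by
      have i3 := integrable_fl h0P fun p => (Φ g p : ℝ)
      refine (i1.sub i3).congr ?_
      filter_upwards [ae_restrict_mem measurableSet_Ico] with x hx
      simp only [Pi.sub_apply, hext g x hx, Rat.cast_sub]
      ring
    rw [e1, integral_sub i1 i2,
      integral_comp_piecewise h0 hrc hmaps hlg (fun x => (g (fl h0 x) : ℝ)), sub_self]
  have hker : LinearMap.ker Φ ≤ Submodule.span ℚ {fun _ => 1} := by
    intro g hg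
    rw [LinearMap.mem_ker] at hg
    have hinv : ∀ x ∈ Ico (0 : ℝ) 1, g (fl h0 (S x)) = g (fl h0 x) := by
      intro x hx
      have := hext g x hx
      rw [hg] at this
      simp only [Pi.zero_apply] at this
      linarith
    have hc := hconst (fun x => g (fl h0 x)) ?_ ?_ hinv
    · rw [Submodule.mem_span_singleton]
      refine ⟨g (fl h0 0), ?_⟩
      ext q
      have hq := hP q (hQP q.2)
      have := hc q hq
      have e : fl h0 (q : ℝ) = q := Subtype.ext (flv_self hq.1 q.2)
      simp only [e] at this
      simp [this]
    · intro x _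
      filter_upwards [flv_right Q x] with y hy
      have e1 : fl h0 y = fl h0 x := Subtype.ext hy
      rw [e1]
    · refine Q.finite_toSet.subset ?_
      rintro x ⟨_, hx⟩
      by_contra hxQ
      apply hx
      filter_upwards [flv_left hxQ] with y hy
      have e1 : fl h0 y = fl h0 x := Subtype.ext hy
      rw [e1]
  have hran : Submodule.span ℚ (Set.range lam) ≤ LinearMap.range (intP h0P) := by
    rw [Submodule.span_le]
    rintro _ ⟨a, rfl⟩
    obtain ⟨u, hu, v, hv, huv, hl⟩ := hlam a
    refine ⟨fun p => if u ≤ (p : ℝ) ∧ (p : ℝ) < v then 1 else 0, ?_⟩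
    change (∫ x in Ico (0 : ℝ) 1, (((if u ≤ flv P x ∧ flv P x < v then 1 else 0 : ℚ)) : ℝ)) = _
    have hu0 := hP u hu
    have hv1 : v ≤ 1 := by
      rcases Finset.mem_insert.1 hv with h | h
      · exact h.le
      · exact (hP v h).2.le
    have e1 : (∫ x in Ico (0 : ℝ) 1, (((if u ≤ flv P x ∧ flv P x < v then 1 else 0 : ℚ)) : ℝ))
        = ∫ x in Ico (0 : ℝ) 1, (Ico u v).indicator (fun _ => (1 : ℝ)) x := by
      refine setIntegral_congr_fun measurableSet_Ico fun x hx => ?_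
      have a1 : u ≤ flv P x ↔ u ≤ x := ⟨fun h => h.trans (flv_le hx.1), fun h => le_flv hu h⟩
      have a2 : flv P x < v ↔ x < v := by
        refine ⟨fun h => ?_, fun h => lt_of_le_of_lt (flv_le hx.1) h⟩
        rcases Finset.mem_insert.1 hv with h' | h'
        · rw [h']; exact hx.2
        · by_contra hc
          exact absurd (le_flv h' (not_lt.1 hc)) (not_le.2 h)
      simp only [a1, a2, Set.indicator_apply, Set.mem_Ico]
      split_ifs <;> simp
    rw [e1, setIntegral_indicator measurableSet_Ico]
    have e2 : Ico (0 : ℝ) 1 ∩ Ico u v = Ico u v := by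
      rw [Set.inter_eq_right]
      exact Set.Ico_subset_Ico hu0.1 hv1
    rw [e2, hl]
    simp [huv]
  have d1 := LinearMap.finrank_range_add_finrank_ker Φ
  have d2 := LinearMap.finrank_range_add_finrank_ker (intP h0P)
  have d3 : Module.finrank ℚ (LinearMap.range Φ) ≤ Module.finrank ℚ (LinearMap.ker (intP h0P)) := by
    apply Submodule.finrank_mono
    rintro _ ⟨g, rfl⟩
    exact hIΦ g
  have d4 : Module.finrank ℚ (LinearMap.ker Φ) ≤ 1 := by
    refine (Submodule.finrank_mono hker).trans ?_
    refine (finrank_span_le_card _).trans ?_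
    simp
  have d5 : m ≤ Module.finrank ℚ (LinearMap.range (intP h0P)) := by
    have := Submodule.finrank_mono hran
    rwa [finrank_span_eq_card hli, Fintype.card_fin] at this
  simp only [Module.finrank_fintype_fun_eq_card, Fintype.card_coe] at d1 d2
  omega

/-! ### Roots -/

namespace Sys

variable {T S : Equiv.Perm ℝ} {B : Set ℝ}

lemma lg_pow (h : Sys T B) {x : ℝ} (hx : x ∈ Ico (0 : ℝ) 1) (N : ℕ)
    (hB : ∀ l < N, (T ^ l) x ∉ B) : LG (T ^ N) x ((T ^ N) x) :=
  LG.pow_of N fun l hl => h.lg _ ((maps_pow h.maps l x).2 hx) (hB l hl)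

lemma step2 (h : Sys T B) (hfin : (DS S).Finite)
    (hmaps : ∀ x, S x ∈ Ico (0 : ℝ) 1 ↔ x ∈ Ico (0 : ℝ) 1) (hcomm : Commute S T)
    {β : ℝ} (hβ : β ∈ B) (hβ0 : β ≠ 0)
    (hsing : ∀ M : ℕ, 2 ≤ M → ∃ z, z ≠ (T ^ M) β ∧ LG (T ^ M) β z) :
    ∃ k : ℤ, (T ^ k) (S β) ∈ B := by
  by_contra hc
  push Not at hc
  have hβI := h.sub hβ
  obtain ⟨K, hK⟩ := h.exists_neg_avoid hβI hfin
  obtain ⟨M, hM2, hM⟩ := h.exists_pos_avoid hβI hfin 2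
  obtain ⟨z, hz, hzl⟩ := hsing M hM2
  set w := ((T ^ K)⁻¹) β with hw
  have hTw : (T ^ K) w = β := perm_apply_inv _ _
  have hwI : w ∈ Ico (0 : ℝ) 1 := (maps_pow h.maps K w).1 (by rwa [hTw])
  have hwl : LG (T ^ K) w β := by
    have := h.lg_pow hwI K ?_
    · rwa [hTw] at this
    · intro l hl hB
      have := h.conn (K - l) (by omega) _ hB β hβ (by
        rw [← Equiv.Perm.mul_apply, ← pow_add, Nat.sub_add_cancel hl.le, hTw])
      exact hβ0 this.2.1
  have h1 : LG (T ^ (M + K)) w z := by rw [pow_add]; exact hwl.comp hzl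
  have h2 : LG S w (S w) := by
    by_contra hn; exact hK hn
  have hcN : ∀ N : ℕ, ∀ x, (T ^ N) (S x) = S ((T ^ N) x) := by
    intro N x
    rw [← Equiv.Perm.mul_apply, ← Equiv.Perm.mul_apply, (hcomm.pow_right N).eq]
  have h3 : LG (T ^ (M + K)) (S w) ((T ^ (M + K)) (S w)) := by
    apply h.lg_pow ((hmaps w).2 hwI)
    intro l _ hB
    apply hc (l - K)
    have : (T ^ ((l : ℤ) - K)) (S β) = (T ^ l) (S w) := by
      rw [← hTw, ← hcN, ← zpow_natCast T K, ← Equiv.Perm.mul_apply, ← zpow_add, sub_add_cancel,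
        zpow_natCast]
    rwa [this]
  have e : (T ^ (M + K)) (S w) = S ((T ^ M) β) := by
    rw [hcN, pow_add, Equiv.Perm.mul_apply, hTw]
  rw [e] at h3
  have h4 := h1.inv.comp (h2.comp h3)
  rw [← (hcomm.pow_right (M + K)).eq, mul_assoc, mul_inv_cancel, mul_one] at h4
  have h5 : LG S ((T ^ M) β) (S ((T ^ M) β)) := by
    by_contra hn; exact hM hn
  exact hz (h4.inv.unique h5.inv)

lemma step3 (h : Sys T B) (hrc : RC S) (hfin : (DS S).Finite)
    {n : ℕ} (hn : 2 ≤ n) (hST : S ^ n = T)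
    {β : ℝ} (hβ : β ∈ B) (k : ℤ) (hk : (T ^ k) (S β) = β) : False := by
  have hcomm : Commute S T := by rw [← hST]; exact (Commute.refl S).pow_right n
  set R := T ^ k * S with hR
  have hRrc : RC R := (h.rc.zpow k).mul hrc
  have hTfin : (DS T).Finite := by rw [← hST]; exact DS.pow_finite hfin n
  have hRfin : (DS R).Finite := DS.mul_finite (DS.zpow_finite hTfin k) hfin
  have hRT : Commute R T := ((Commute.refl T).zpow_left k).mul_left hcomm
  have hRx : ∀ x ∈ Ico (0 : ℝ) 1, (R x = x) = (R 0 = 0) := by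
    refine h.invariant_const (fun x => R x = x) ?_ ?_ ?_
    · intro x _
      filter_upwards [hRrc x] with y hy
      rw [hy, eq_iff_iff]
      constructor <;> intro h' <;> linarith
    · refine hRfin.subset ?_
      rintro x ⟨_, hx⟩ hl
      apply hx
      unfold LG at hl
      filter_upwards [hl] with y hy
      rw [hy, eq_iff_iff]
      constructor <;> intro h' <;> linarith
    · intro x _
      have : R (T x) = T (R x) := by
        rw [← Equiv.Perm.mul_apply, ← Equiv.Perm.mul_apply, hRT.eq]
      rw [this, eq_iff_iff]
      exact T.injective.eq_iff
  have hR0 : R 0 = 0 := by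
    rw [← hRx β (h.sub hβ)]; exact hk
  have hRn : (R ^ n) 0 = 0 := by
    clear hST hn
    induction n with
    | zero => simp
    | succ n ih => rw [pow_succ, Equiv.Perm.mul_apply, hR0, ih]
  have hRn' : R ^ n = T ^ (k * n + 1) := by
    rw [hR, (hcomm.zpow_right k).symm.mul_pow, hST, zpow_add, zpow_one, zpow_mul, zpow_natCast]
  have := h.zpow_inj (h.sub h.zero) (a₁ := k * n + 1) (a₂ := 0) (by
    simp only [← hRn', hRn, zpow_zero, Equiv.Perm.one_apply])
  have hdvd : (n : ℤ) ∣ 1 := ⟨-k, by linarith⟩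
  have := Int.le_of_dvd one_pos hdvd
  omega

lemma lg_of_orbit_avoid (h : Sys T B) (hfin : (DS S).Finite)
    (hmaps : ∀ x, S x ∈ Ico (0 : ℝ) 1 ↔ x ∈ Ico (0 : ℝ) 1)
    {n : ℕ} (hST : S ^ n = T) {x : ℝ} (hx : x ∈ Ico (0 : ℝ) 1)
    (hav : ∀ k : ℤ, (S ^ k) x ∉ B) : LG S x (S x) := by
  obtain ⟨K, hK⟩ := h.exists_neg_avoid hx hfin
  set w := ((T ^ K)⁻¹) x with hw
  have hTw : (T ^ K) w = x := perm_apply_inv _ _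
  have hwS : w = (S ^ (-(n * K : ℕ) : ℤ)) x := by
    rw [hw, zpow_neg, zpow_natCast, pow_mul, hST]
  have hwI : w ∈ Ico (0 : ℝ) 1 := (maps_pow h.maps K w).1 (by rwa [hTw])
  have a1 : LG (T ^ K) w x := by
    have := h.lg_pow hwI K ?_
    · rwa [hTw] at this
    · intro l _ hB
      apply hav (((n * l : ℕ) : ℤ) + (-(n * K : ℕ) : ℤ))
      rwa [zpow_add, Equiv.Perm.mul_apply, ← hwS, zpow_natCast, pow_mul, hST]
  have a2 : LG S w (S w) := by
    by_contra hn; exact hK hn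
  have hcomm : Commute S (T ^ K) := by
    rw [← hST]; exact ((Commute.refl S).pow_right n).pow_right K
  have a3 : LG (T ^ K) (S w) ((T ^ K) (S w)) := by
    apply h.lg_pow ((hmaps w).2 hwI)
    intro l _ hB
    apply hav (((n * l : ℕ) : ℤ) + (1 + (-(n * K : ℕ) : ℤ)))
    rwa [zpow_add, Equiv.Perm.mul_apply, zpow_add, Equiv.Perm.mul_apply, ← hwS, zpow_one,
      zpow_natCast, pow_mul, hST]
  have e : (T ^ K) (S w) = S x := by
    rw [← Equiv.Perm.mul_apply, ← hcomm.eq, Equiv.Perm.mul_apply, hTw]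
  rw [e] at a3
  have := a1.inv.comp (a2.comp a3)
  rwa [← hcomm.eq, mul_assoc, mul_inv_cancel, mul_one] at this

lemma rank_bound (h : Sys T B) (hrc : RC S) (hfin : (DS S).Finite)
    (hmaps : ∀ x, S x ∈ Ico (0 : ℝ) 1 ↔ x ∈ Ico (0 : ℝ) 1)
    {n : ℕ} (hST : S ^ n = T) (C : Finset ℝ) (hC : ∀ c ∈ C, c ∈ Ico (0 : ℝ) 1)
    (hcov : ∀ b ∈ B, ∃ c ∈ C, ∃ k : ℤ, (S ^ k) c = b)
    {m : ℕ} (lam : Fin m → ℝ) (hli : LinearIndependent ℚ lam)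
    (hlam : ∀ a, ∃ u ∈ B, ∃ v ∈ insert 1 B, u ≤ v ∧ lam a = v - u) : m ≤ C.card + 1 := by
  classical
  set F : Set ℝ := B ∪ (DS S ∩ Ico 0 1) with hF
  have hFfin : F.Finite := h.fin.union (hfin.inter_of_left _)
  have hFcov : ∀ b ∈ F, ∃ k : ℤ, ∃ c ∈ C, (S ^ k) c = b := by
    rintro b (hb | hb)
    · obtain ⟨c, hc, k, hk⟩ := hcov b hb
      exact ⟨k, c, hc, hk⟩
    · have : ∃ k : ℤ, (S ^ k) b ∈ B := by
        by_contra hno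
        push Not at hno
        exact hb.1 (h.lg_of_orbit_avoid hfin hmaps hST hb.2 hno)
      obtain ⟨k, hk⟩ := this
      obtain ⟨c, hc, k', hk'⟩ := hcov _ hk
      refine ⟨-k + k', c, hc, ?_⟩
      rw [zpow_add, Equiv.Perm.mul_apply, hk', zpow_neg, perm_inv_apply]
  choose! κ hκ using hFcov
  obtain ⟨N, hN⟩ : ∃ N : ℕ, ∀ b ∈ F, (κ b).natAbs ≤ N := by
    have := (hFfin.image fun b => (κ b).natAbs).bddAbove
    obtain ⟨N, hN⟩ := this
    exact ⟨N, fun b hb => hN ⟨b, hb, rfl⟩⟩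
  set Q : Finset ℝ := (Finset.Icc (-(N : ℤ)) N ×ˢ C).image fun p => (S ^ p.1) p.2 with hQ
  have hFQ : ∀ b ∈ F, b ∈ Q := by
    intro b hb
    obtain ⟨c, hc, hk⟩ := hκ b hb
    rw [hQ, Finset.mem_image]
    refine ⟨(κ b, c), ?_, hk⟩
    have := hN b hb
    simp only [Finset.mem_product, Finset.mem_Icc]
    exact ⟨⟨by omega, by omega⟩, hc⟩
  set P : Finset ℝ := Q ∪ Q.image (S⁻¹ : Equiv.Perm ℝ) with hP
  have hQI : ∀ q ∈ Q, q ∈ Ico (0 : ℝ) 1 := by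
    intro q hq
    rw [hQ, Finset.mem_image] at hq
    obtain ⟨p, hp, rfl⟩ := hq
    exact (maps_zpow hmaps _ _).2 (hC _ (Finset.mem_product.1 hp).2)
  have hPI : ∀ q ∈ P, q ∈ Ico (0 : ℝ) 1 := by
    intro q hq
    rcases Finset.mem_union.1 hq with h' | h'
    · exact hQI q h'
    · obtain ⟨p, hp, rfl⟩ := Finset.mem_image.1 h'
      exact (hmaps _).1 (by rw [perm_apply_inv]; exact hQI p hp)
  have hcard : P.card ≤ Q.card + C.card := by
    have hsub : P ⊆ Q ∪ C.image (S ^ (-(N : ℤ) - 1) : Equiv.Perm ℝ) := by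
      intro p hp
      rcases Finset.mem_union.1 hp with h' | h'
      · exact Finset.mem_union_left _ h'
      · obtain ⟨q, hq, rfl⟩ := Finset.mem_image.1 h'
        rw [hQ, Finset.mem_image] at hq
        obtain ⟨⟨k, c⟩, hkc, rfl⟩ := hq
        simp only [Finset.mem_product, Finset.mem_Icc] at hkc
        have e : S⁻¹ ((S ^ k) c) = (S ^ (k - 1)) c := by
          rw [← zpow_neg_one, ← Equiv.Perm.mul_apply, ← zpow_add]; congr 2; ring
        simp only [e]
        by_cases hk : k = -N
        · refine Finset.mem_union_right _ (Finset.mem_image.2 ⟨c, hkc.2, ?_⟩)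
          rw [hk]
        · refine Finset.mem_union_left _ (Finset.mem_image.2 ⟨(k - 1, c), ?_, rfl⟩)
          simp only [Finset.mem_product, Finset.mem_Icc]
          exact ⟨⟨by omega, by omega⟩, hkc.2⟩
    have c1 := Finset.card_le_card hsub
    have c2 := Finset.card_union_le Q (C.image (S ^ (-(N : ℤ) - 1) : Equiv.Perm ℝ))
    have c3 : (C.image (S ^ (-(N : ℤ) - 1) : Equiv.Perm ℝ)).card ≤ C.card := Finset.card_image_le
    omega
  have key := rank_ineq (S := S) (P := P) (Q := Q) (hFQ 0 (Or.inl h.zero))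
    Finset.subset_union_left hPI hrc hmaps ?_ ?_ ?_ lam hli ?_
  · omega
  · intro x hx hxQ
    by_contra hn
    exact hxQ (hFQ x (Or.inr ⟨hn, hx⟩))
  · intro x hx
    refine Finset.mem_union_right _ (Finset.mem_image.2 ⟨S x, hx, perm_inv_apply S x⟩)
  · intro f hr hf hinv
    refine h.invariant_const f hr hf ?_
    have : ∀ k : ℕ, ∀ x ∈ Ico (0 : ℝ) 1, f ((S ^ k) x) = f x := by
      intro k
      induction k with
      | zero => intro x _; simp
      | succ k ih =>
        intro x hx
        rw [pow_succ', Equiv.Perm.mul_apply, hinv _ ((maps_pow hmaps k x).2 hx), ih x hx]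
    rw [← hST]
    exact this n
  · intro a
    obtain ⟨u, hu, v, hv, huv, hl⟩ := hlam a
    refine ⟨u, Finset.mem_union_left _ (hFQ u (Or.inl hu)), v, ?_, huv, hl⟩
    rcases hv with h' | h'
    · rw [h']; exact Finset.mem_insert_self _ _
    · exact Finset.mem_insert_of_mem (Finset.mem_union_left _ (hFQ v (Or.inl h')))

/-- Abstract no-root theorem. -/
lemma no_root (h : Sys T B) (hrc : RC S) (hfin : (DS S).Finite)
    (hmaps : ∀ x, S x ∈ Ico (0 : ℝ) 1 ↔ x ∈ Ico (0 : ℝ) 1)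
    {n : ℕ} (hn : 2 ≤ n) (hST : S ^ n = T)
    {β β₀ : ℝ} (hβ : β ∈ B) (hβ0 : β ≠ 0) (hβ₀ : β₀ ∈ B) (hββ₀ : β ≠ β₀) (hTβ₀ : T β₀ = 0)
    (hsing : ∀ M : ℕ, 2 ≤ M → ∃ z, z ≠ (T ^ M) β ∧ LG (T ^ M) β z)
    {m : ℕ} (hm : 2 ≤ m) (hcard : B.ncard ≤ m) (lam : Fin m → ℝ) (hli : LinearIndependent ℚ lam)
    (hlam : ∀ a, ∃ u ∈ B, ∃ v ∈ insert 1 B, u ≤ v ∧ lam a = v - u) : False := by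
  classical
  have hcomm : Commute S T := by rw [← hST]; exact (Commute.refl S).pow_right n
  have hβ₀0 : β₀ ≠ 0 := by
    intro h0
    have := h.conn 1 le_rfl β₀ hβ₀ 0 h.zero (by simpa using hTβ₀)
    exact this.2.2 h0
  have hTk : ∀ k : ℤ, T ^ k = S ^ (n * k) := by
    intro k; rw [zpow_mul, zpow_natCast, hST]
  obtain ⟨k, b, hb, hb0, hk⟩ : ∃ k : ℤ, ∃ b ∈ B, b ≠ 0 ∧ (T ^ k) (S β) = b := by
    obtain ⟨k, hk⟩ := h.step2 hfin hmaps hcomm hβ hβ0 hsing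
    by_cases h0 : (T ^ k) (S β) = 0
    · refine ⟨-1 + k, β₀, hβ₀, hβ₀0, ?_⟩
      rw [zpow_add, Equiv.Perm.mul_apply, h0, zpow_neg_one, ← hTβ₀, perm_inv_apply]
    · exact ⟨k, _, hk, h0, rfl⟩
  by_cases hbβ : b = β
  · exact h.step3 hrc hfin hn hST hβ k (hk.trans hbβ)
  set C : Finset ℝ := (h.fin.toFinset.erase 0).erase β with hC
  have hmemC : ∀ c, c ∈ C ↔ c ≠ β ∧ c ≠ 0 ∧ c ∈ B := by
    intro c; simp [hC]
  have hCc : C.card + 2 ≤ m := by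
    rw [hC]
    have h1 : (0 : ℝ) ∈ h.fin.toFinset := by simpa using h.zero
    have h2 : β ∈ h.fin.toFinset.erase 0 := by simp [hβ, hβ0]
    have c1 := Finset.card_erase_add_one h1
    have c2 := Finset.card_erase_add_one h2
    rw [Set.ncard_eq_toFinset_card B h.fin] at hcard
    omega
  have := h.rank_bound hrc hfin hmaps hST C (fun c hc => h.sub ((hmemC c).1 hc).2.2) ?_ lam hli hlam
  · omega
  · intro x hx
    by_cases hx0 : x = 0
    · refine ⟨β₀, (hmemC _).2 ⟨hββ₀.symm, hβ₀0, hβ₀⟩, n, ?_⟩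
      rw [zpow_natCast, hST, hTβ₀, hx0]
    by_cases hxβ : x = β
    · refine ⟨b, (hmemC _).2 ⟨hbβ, hb0, hb⟩, -(n * k + 1), ?_⟩
      rw [hxβ, ← hk, hTk, zpow_neg, zpow_add, zpow_one, ← Equiv.Perm.mul_apply (S ^ ((n : ℤ) * k)) S,
        perm_inv_apply]
    · exact ⟨x, (hmemC _).2 ⟨hxβ, hx0, hx⟩, 0, by simp⟩

end Sys

/-! ### Elementary facts on `betaPt` and `ietMap` -/

section beta

variable {m : ℕ} {lam : Fin m → ℝ}

lemma betaPt_zero (lam : Fin m → ℝ) : betaPt lam 0 = 0 := by simp [betaPt]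

lemma betaPt_succ (lam : Fin m → ℝ) (a : Fin m) :
    betaPt lam ((a : ℕ) + 1) = betaPt lam a + lam a := by
  unfold betaPt
  have : Finset.univ.filter (fun i : Fin m => (i : ℕ) < (a : ℕ) + 1)
      = insert a (Finset.univ.filter (fun i : Fin m => (i : ℕ) < (a : ℕ))) := by
    ext i
    simp only [Finset.mem_filter, Finset.mem_univ, true_and, Finset.mem_insert, Fin.ext_iff]
    omega
  rw [this, Finset.sum_insert (by simp), add_comm]

lemma betaPt_top (hsum : ∑ i, lam i = 1) : betaPt lam m = 1 := by
  simp [betaPt, hsum]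

lemma betaPt_mono (hpos : ∀ i, 0 < lam i) : Monotone (betaPt lam) := by
  intro i j hij
  unfold betaPt
  refine Finset.sum_le_sum_of_subset_of_nonneg ?_ fun i _ _ => (hpos i).le
  intro a ha
  simp only [Finset.mem_filter, Finset.mem_univ, true_and] at *
  omega

lemma betaPt_lt (hpos : ∀ i, 0 < lam i) {i j : ℕ} (hij : i < j) (hi : i < m) :
    betaPt lam i < betaPt lam j := by
  have h1 := betaPt_succ lam ⟨i, hi⟩
  have h2 : betaPt lam (i + 1) ≤ betaPt lam j := betaPt_mono hpos hij
  have := hpos ⟨i, hi⟩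
  simp only at h1
  linarith

lemma exists_piece (hsum : ∑ i, lam i = 1) {x : ℝ} (hx : x ∈ Ico (0 : ℝ) 1) :
    ∃ a : Fin m, x ∈ Ico (betaPt lam a) (betaPt lam a + lam a) := by
  have : ∀ j : ℕ, j ≤ m → x < betaPt lam j →
      ∃ a : Fin m, x ∈ Ico (betaPt lam a) (betaPt lam a + lam a) := by
    intro j
    induction j with
    | zero => intro _ h; rw [betaPt_zero] at h; exact absurd hx.1 (not_le.2 h)
    | succ j ih =>
      intro hj h
      by_cases hlt : x < betaPt lam j
      · exact ih (by omega) hlt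
      · refine ⟨⟨j, hj⟩, not_lt.1 hlt, ?_⟩
        rw [← betaPt_succ]; exact h
  exact this m le_rfl (by rw [betaPt_top hsum]; exact hx.2)

lemma piece_unique (hpos : ∀ i, 0 < lam i) {x : ℝ} {a a' : Fin m}
    (h : x ∈ Ico (betaPt lam a) (betaPt lam a + lam a))
    (h' : x ∈ Ico (betaPt lam a') (betaPt lam a' + lam a')) : a = a' := by
  rw [← betaPt_succ] at h h'
  by_contra hne
  rcases lt_or_gt_of_ne hne with hlt | hlt
  · have := betaPt_mono (lam := lam) hpos (show (a : ℕ) + 1 ≤ a' from hlt)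
    linarith [h.2, h'.1]
  · have := betaPt_mono (lam := lam) hpos (show (a' : ℕ) + 1 ≤ a from hlt)
    linarith [h'.2, h.1]

lemma betaPt_mem_Ico (hpos : ∀ i, 0 < lam i) (hsum : ∑ i, lam i = 1) (a : Fin m) :
    betaPt lam a ∈ Ico (0 : ℝ) 1 := by
  refine ⟨?_, ?_⟩
  · rw [← betaPt_zero lam]; exact betaPt_mono hpos (Nat.zero_le _)
  · rw [← betaPt_top hsum]; exact betaPt_lt hpos a.2 a.2

lemma betaPt_inj (hpos : ∀ i, 0 < lam i) {a a' : Fin m}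
    (h : betaPt lam a = betaPt lam a') : a = a' := by
  refine piece_unique hpos (x := betaPt lam a) ⟨le_rfl, ?_⟩ ⟨h.ge, ?_⟩
  · linarith [hpos a]
  · linarith [hpos a']

/-- Left endpoints of the image intervals. -/
noncomputable def imgL (π : Equiv.Perm (Fin m)) (lam : Fin m → ℝ) (r : ℕ) : ℝ :=
  betaPt (fun k => lam (π.symm k)) r

lemma imgL_eq (π : Equiv.Perm (Fin m)) (lam : Fin m → ℝ) (r : ℕ) :
    imgL π lam r = ∑ i ∈ Finset.univ.filter (fun i : Fin m => (π i : ℕ) < r), lam i := by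
  unfold imgL betaPt
  rw [Finset.sum_filter, Finset.sum_filter, ← Equiv.sum_comp π]
  simp

lemma imgL_succ (π : Equiv.Perm (Fin m)) (lam : Fin m → ℝ) (a : Fin m) :
    imgL π lam ((π a : ℕ) + 1) = imgL π lam (π a) + lam a := by
  unfold imgL
  rw [betaPt_succ]; simp

lemma imgL_top (π : Equiv.Perm (Fin m)) (hsum : ∑ i, lam i = 1) : imgL π lam m = 1 := by
  apply betaPt_top
  rw [← hsum]; exact Equiv.sum_comp π.symm lam

lemma imgL_ne_zero (π : Equiv.Perm (Fin m)) (hpos : ∀ i, 0 < lam i) {r : ℕ} (hr : 0 < r)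
    (hm : 0 < m) : imgL π lam r ≠ 0 := by
  have := betaPt_lt (lam := fun k => lam (π.symm k)) (fun i => hpos _) hr hm
  rw [betaPt_zero] at this
  exact this.ne'

lemma ietMap_eq (π : Equiv.Perm (Fin m)) (hpos : ∀ i, 0 < lam i) {x : ℝ} {a : Fin m}
    (h : x ∈ Ico (betaPt lam a) (betaPt lam a + lam a)) :
    ietMap π lam x = x - betaPt lam a + imgL π lam (π a) := by
  have hex : ∃ j : Fin m, x ∈ Ico (betaPt lam j) (betaPt lam j + lam j) := ⟨a, h⟩
  unfold ietMap
  rw [dif_pos hex, piece_unique hpos hex.choose_spec h, imgL_eq]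
  rfl

end beta

section idoc

variable {m : ℕ} {lam : Fin m → ℝ} {π : Equiv.Perm (Fin m)}

lemma exists_inversion (hirr : IrreduciblePerm π) {v : ℕ} (h1 : 1 ≤ v) (h2 : v < m) :
    ∃ a a' : Fin m, (a : ℕ) < v ∧ v ≤ (a' : ℕ) ∧ v ≤ (π a : ℕ) ∧ (π a' : ℕ) < v := by
  obtain ⟨a, ha, ha'⟩ := hirr v h1 h2
  by_contra hc
  push Not at hc
  have hc' : ∀ a' : Fin m, v ≤ (a' : ℕ) → v ≤ (π a' : ℕ) := fun a' h => hc a a' ha h ha'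
  set F := Finset.univ.filter (fun i : Fin m => v ≤ (i : ℕ)) with hF
  have hsub : F.image π ⊆ F := by
    intro x hx
    obtain ⟨y, hy, rfl⟩ := Finset.mem_image.1 hx
    simp only [hF, Finset.mem_filter, Finset.mem_univ, true_and] at *
    exact hc' y hy
  have heq := Finset.eq_of_subset_of_card_le hsub
    (by rw [Finset.card_image_of_injective _ π.injective])
  have : π a ∈ F.image π := by rw [heq]; simp [hF, ha']
  obtain ⟨y, hy, hya⟩ := Finset.mem_image.1 this
  rw [π.injective hya] at hy
  simp only [hF, Finset.mem_filter, Finset.mem_univ, true_and] at hy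
  omega

lemma idoc_comb (hirr : IrreduciblePerm π) (hli : LinearIndependent ℚ lam)
    (k : ℕ) (c : ℕ → Fin m)
    (hsum : ∑ l ∈ Finset.range k, imgL π lam (π (c l))
      = ∑ l ∈ Finset.range k, betaPt lam (c (l + 1))) :
    ∀ l < k, (c (l + 1) : ℕ) = 0 ∧ (π (c l) : ℕ) = 0 := by
  set N1 : Fin m → Finset ℕ := fun a => (Finset.range k).filter fun l => (π a : ℕ) < π (c l)
    with hN1
  set N2 : Fin m → Finset ℕ := fun a => (Finset.range k).filter fun l => (a : ℕ) < c (l + 1)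
    with hN2
  have hN : ∀ a, (N1 a).card = (N2 a).card := by
    have e1 : ∑ l ∈ Finset.range k, imgL π lam (π (c l)) = ∑ a, ((N1 a).card : ℝ) * lam a := by
      simp only [imgL_eq, Finset.sum_filter]
      rw [Finset.sum_comm]
      refine Finset.sum_congr rfl fun a _ => ?_
      rw [← Finset.sum_filter, Finset.sum_const, nsmul_eq_mul]
    have e2 : ∑ l ∈ Finset.range k, betaPt lam (c (l + 1)) = ∑ a, ((N2 a).card : ℝ) * lam a := by
      simp only [betaPt, Finset.sum_filter]
      rw [Finset.sum_comm]
      refine Finset.sum_congr rfl fun a _ => ?_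
      rw [← Finset.sum_filter, Finset.sum_const, nsmul_eq_mul]
    have := Fintype.linearIndependent_iff.1 hli
      (fun a => ((N1 a).card : ℚ) - ((N2 a).card : ℚ)) (by
        simp only [Rat.smul_def, Rat.cast_sub, Rat.cast_natCast, sub_mul, Finset.sum_sub_distrib]
        rw [← e1, ← e2, hsum, sub_self])
    intro a
    have h := this a
    simp only [sub_eq_zero] at h
    exact_mod_cast h
  have hinv : ∀ a a' : Fin m, (a : ℕ) < a' → (π a' : ℕ) < π a →
      N1 a = N1 a' ∧ N2 a' = N2 a := by
    intro a a' h h'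
    have s1 : N1 a ⊆ N1 a' := by
      intro l hl
      simp only [hN1, Finset.mem_filter] at *
      exact ⟨hl.1, by omega⟩
    have s2 : N2 a' ⊆ N2 a := by
      intro l hl
      simp only [hN2, Finset.mem_filter] at *
      exact ⟨hl.1, by omega⟩
    have c1 := Finset.card_le_card s1
    have c2 := Finset.card_le_card s2
    have d1 := hN a
    have d2 := hN a'
    exact ⟨Finset.eq_of_subset_of_card_le s1 (by omega),
      Finset.eq_of_subset_of_card_le s2 (by omega)⟩
  intro l hl
  constructor
  · by_contra hne
    obtain ⟨a, a', h1, h2, h3, h4⟩ := exists_inversion hirr (v := c (l + 1))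
      (Nat.one_le_iff_ne_zero.2 hne) (c (l + 1)).2
    have := (hinv a a' (by omega) (by omega)).2
    have hl' : l ∈ N2 a := by
      simp only [hN2, Finset.mem_filter, Finset.mem_range]; exact ⟨hl, h1⟩
    rw [← this] at hl'
    simp only [hN2, Finset.mem_filter] at hl'
    omega
  · by_contra hne
    obtain ⟨a, a', h1, h2, h3, h4⟩ := exists_inversion hirr (v := π (c l))
      (Nat.one_le_iff_ne_zero.2 hne) (π (c l)).2
    have := (hinv a a' (by omega) (by omega)).1
    have hl' : l ∈ N1 a' := by
      simp only [hN1, Finset.mem_filter, Finset.mem_range]; exact ⟨hl, h4⟩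
    rw [← this] at hl'
    simp only [hN1, Finset.mem_filter] at hl'
    omega

end idoc

section iet

variable {m : ℕ} {lam : Fin m → ℝ} {π : Equiv.Perm (Fin m)} {T : Equiv.Perm ℝ}

lemma T_beta (hpos : ∀ i, 0 < lam i) (hT : ∀ x, T x = ietMap π lam x) (a : Fin m) :
    T (betaPt lam a) = imgL π lam (π a) := by
  rw [hT, ietMap_eq π hpos (a := a) ⟨le_rfl, by linarith [hpos a]⟩]; ring

lemma T_left (hpos : ∀ i, 0 < lam i) (hT : ∀ x, T x = ietMap π lam x) (a : Fin m) :
    LG T (betaPt lam ((a : ℕ) + 1)) (imgL π lam ((π a : ℕ) + 1)) := by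
  have hlt : betaPt lam a < betaPt lam ((a : ℕ) + 1) := by
    rw [betaPt_succ]; linarith [hpos a]
  filter_upwards [Ioo_mem_nhdsLT hlt] with y hy
  rw [hT, ietMap_eq π hpos (a := a) ⟨hy.1.le, by rw [← betaPt_succ]; exact hy.2⟩, imgL_succ,
    betaPt_succ]
  ring

lemma T_regular (hpos : ∀ i, 0 < lam i) (hsum : ∑ i, lam i = 1)
    (hT : ∀ x, T x = ietMap π lam x) {x : ℝ} (hx : x ∈ Ico (0 : ℝ) 1)
    (hxB : x ∉ Set.range fun a : Fin m => betaPt lam a) : LG T x (T x) := by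
  obtain ⟨a, ha⟩ := exists_piece hsum hx
  have hlt : betaPt lam a < x := lt_of_le_of_ne ha.1 fun h => hxB ⟨a, h⟩
  filter_upwards [Ioo_mem_nhdsLT hlt] with y hy
  rw [hT, hT, ietMap_eq π hpos ha, ietMap_eq π hpos (a := a) ⟨hy.1.le, hy.2.trans ha.2⟩]
  ring

lemma sys_of_iet (hm : 3 ≤ m) (hirr : IrreduciblePerm π) (hpos : ∀ i, 0 < lam i)
    (hsum : ∑ i, lam i = 1) (hli : LinearIndependent ℚ lam)
    (hT : ∀ x, T x = ietMap π lam x)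
    (hmaps : ∀ x, T x ∈ Ico (0 : ℝ) 1 ↔ x ∈ Ico (0 : ℝ) 1) (hrc : RC T) :
    Sys T (Set.range fun a : Fin m => betaPt lam a) where
  fin := Set.finite_range _
  sub := by rintro _ ⟨a, rfl⟩; exact betaPt_mem_Ico hpos hsum a
  zero := ⟨⟨0, by omega⟩, betaPt_zero lam⟩
  maps := hmaps
  rc := hrc
  lg x hx hxB := T_regular hpos hsum hT hx hxB
  conn := by
    rintro k hk _ ⟨i, rfl⟩ _ ⟨j, rfl⟩ hij
    simp only at hij ⊢
    have hmem : ∀ l : ℕ, (T ^ l) (betaPt lam i) ∈ Ico (0 : ℝ) 1 := fun l =>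
      (maps_pow hmaps l _).2 (betaPt_mem_Ico hpos hsum i)
    choose c hc using fun l => exists_piece (lam := lam) hsum (hmem l)
    have hc0 : c 0 = i := by
      refine piece_unique hpos (hc 0) ?_
      rw [pow_zero, Equiv.Perm.one_apply]
      exact ⟨le_rfl, by linarith [hpos i]⟩
    have hck : c k = j := by
      refine piece_unique hpos (hc k) ?_
      rw [hij]
      exact ⟨le_rfl, by linarith [hpos j]⟩
    have hstep : ∀ l, (T ^ (l + 1)) (betaPt lam i)
        = (T ^ l) (betaPt lam i) - betaPt lam (c l) + imgL π lam (π (c l)) := by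
      intro l
      rw [pow_succ', Equiv.Perm.mul_apply, hT, ietMap_eq π hpos (hc l)]
    have htot : ∀ K : ℕ, (T ^ K) (betaPt lam i) + ∑ l ∈ Finset.range K, betaPt lam (c l)
        = betaPt lam i + ∑ l ∈ Finset.range K, imgL π lam (π (c l)) := by
      intro K
      induction K with
      | zero => simp
      | succ K ih =>
        rw [Finset.sum_range_succ, Finset.sum_range_succ, hstep]
        linarith
    have hs : ∑ l ∈ Finset.range k, imgL π lam (π (c l))
        = ∑ l ∈ Finset.range k, betaPt lam (c (l + 1)) := by
      have h1 := Finset.sum_range_succ (fun l => betaPt lam (c l)) k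
      have h2 := Finset.sum_range_succ' (fun l => betaPt lam (c l)) k
      have h3 := htot k
      rw [hij] at h3
      rw [hc0] at h2
      rw [hck] at h1
      linarith
    have key := idoc_comb hirr hli k c hs
    have hπ0 : (π ⟨0, by omega⟩ : ℕ) ≠ 0 := by
      obtain ⟨a, ha, ha'⟩ := hirr 1 le_rfl (by omega)
      have : a = ⟨0, by omega⟩ := Fin.ext (by simpa using ha)
      rw [this] at ha'
      omega
    have hk1 : k = 1 := by
      by_contra hne
      have k0 := (key 0 (by omega)).1
      have k1 := (key 1 (by omega)).2
      have : c (0 + 1) = ⟨0, by omega⟩ := Fin.ext k0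
      rw [zero_add] at this
      rw [this] at k1
      exact hπ0 k1
    subst hk1
    have k0 := key 0 (by omega)
    rw [zero_add, hck, hc0] at k0
    refine ⟨rfl, ?_, ?_⟩
    · rw [k0.1, betaPt_zero]
    · intro h
      have : i = ⟨0, by omega⟩ := betaPt_inj hpos (by rw [h]; exact (betaPt_zero lam).symm)
      rw [this] at k0
      exact hπ0 k0.2

lemma lg_after (hS : Sys T (Set.range fun a : Fin m => betaPt lam a)) {q : ℝ}
    (hq : q ∈ Set.range fun a : Fin m => betaPt lam a) (hTq : T q ≠ 0) (N : ℕ) :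
    LG (T ^ N) (T q) ((T ^ N) (T q)) := by
  apply hS.lg_pow ((hS.maps q).2 (hS.sub hq))
  intro l _ hB
  have h := hS.conn (l + 1) (by omega) q hq _ hB (by rw [pow_succ, Equiv.Perm.mul_apply])
  have hl : l = 0 := by omega
  subst hl
  exact hTq (by simpa using h.2.1)

lemma singular (hm : 3 ≤ m) (hsep : Separating π) (hpos : ∀ i, 0 < lam i)
    (hsum : ∑ i, lam i = 1) (hT : ∀ x, T x = ietMap π lam x)
    (hS : Sys T (Set.range fun a : Fin m => betaPt lam a))
    {i : Fin m} (hi : (i : ℕ) ≠ 0) (hi0 : (π i : ℕ) ≠ 0) (M : ℕ) (hM : 2 ≤ M) :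
    ∃ z, z ≠ (T ^ M) (betaPt lam i) ∧ LG (T ^ M) (betaPt lam i) z := by
  have hilt := i.2
  obtain ⟨p, hp⟩ : ∃ p : Fin m, (i : ℕ) = p + 1 := ⟨⟨i - 1, by omega⟩, by simp; omega⟩
  have hlp := T_left hpos hT p
  rw [← hp] at hlp
  -- the point following a given image
  have next : ∀ a : Fin m, (π a : ℕ) + 1 < m → ∃ j : Fin m, (π j : ℕ) = π a + 1 ∧
      T (betaPt lam j) = imgL π lam ((π a : ℕ) + 1) ∧ T (betaPt lam j) ≠ 0 := by
    intro a ha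
    refine ⟨π.symm ⟨π a + 1, ha⟩, by simp, ?_, ?_⟩
    · rw [T_beta hpos hT]; simp
    · rw [T_beta hpos hT]
      exact imgL_ne_zero π hpos (by simp) (by omega)
  by_cases hc : (π p : ℕ) + 1 < m
  · obtain ⟨j, hj, hTj, hTj0⟩ := next p hc
    rw [← hTj] at hlp
    obtain ⟨N, rfl⟩ : ∃ N, M = N + 1 := ⟨M - 1, by omega⟩
    refine ⟨(T ^ N) (T (betaPt lam j)), ?_, ?_⟩
    · rw [pow_succ, Equiv.Perm.mul_apply]
      intro h
      have := betaPt_inj hpos (T.injective ((T ^ N).injective h))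
      rw [this] at hj
      exact hsep p i hp hj
    · rw [pow_succ]
      exact hlp.comp (lg_after hS ⟨j, rfl⟩ hTj0 N)
  · have hpm : (π p : ℕ) + 1 = m := by have := (π p).2; omega
    rw [hpm, imgL_top π hsum] at hlp
    set q : Fin m := ⟨m - 1, by omega⟩ with hq
    have hqp : q ≠ p := by
      intro h
      have : (p : ℕ) = m - 1 := by rw [← h]
      omega
    have hπq : (π q : ℕ) + 1 < m := by
      have h1 := (π q).2
      have h2 : (π q : ℕ) ≠ π p := fun h => hqp (π.injective (Fin.ext h))
      omega
    have hlq := T_left hpos hT q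
    have hq1 : (q : ℕ) + 1 = m := by simp only [hq]; omega
    rw [hq1, betaPt_top hsum] at hlq
    obtain ⟨j, hj, hTj, hTj0⟩ := next q hπq
    rw [← hTj] at hlq
    obtain ⟨N, rfl⟩ : ∃ N, M = N + 2 := ⟨M - 2, by omega⟩
    have e : T ^ (N + 2) = T ^ N * (T * T) := by rw [pow_add, pow_two]
    refine ⟨(T ^ N) (T (betaPt lam j)), ?_, ?_⟩
    · rw [e, Equiv.Perm.mul_apply, Equiv.Perm.mul_apply]
      intro h
      have h1 := T.injective ((T ^ N).injective h)
      have := hS.conn 1 le_rfl (betaPt lam i) ⟨i, rfl⟩ (betaPt lam j) ⟨j, rfl⟩ (by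
        rw [pow_one, h1])
      have h2 := this.2.1
      rw [h1, T_beta hpos hT] at h2
      exact imgL_ne_zero π hpos (Nat.pos_of_ne_zero hi0) (by omega) h2
    · rw [e]
      exact (hlp.comp hlq).comp (lg_after hS ⟨j, rfl⟩ hTj0 N)

end iet

/-! ### General interval exchanges -/

lemma iet_perm {S : ℝ → ℝ} (h : IsIET S) : ∃ σ : Equiv.Perm ℝ, (∀ x, σ x = S x) ∧ RC σ ∧
    (DS σ).Finite ∧ ∀ x, σ x ∈ Ico (0 : ℝ) 1 ↔ x ∈ Ico (0 : ℝ) 1 := by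
  obtain ⟨hbij, hout, k, β, hβ, hβ0, hβ1, hpc⟩ := h
  unfold unitI at hbij hout
  have hmaps : ∀ x, S x ∈ Ico (0 : ℝ) 1 ↔ x ∈ Ico (0 : ℝ) 1 := by
    intro x
    constructor
    · intro hx
      by_contra hn
      rw [hout x hn] at hx
      exact hn hx
    · exact fun hx => hbij.mapsTo hx
  have hB : Function.Bijective S := by
    constructor
    · intro x y hxy
      by_cases hx : x ∈ Ico (0 : ℝ) 1
      · have hy : y ∈ Ico (0 : ℝ) 1 := by rw [← hmaps, ← hxy, hmaps]; exact hx
        exact hbij.injOn hx hy hxy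
      · have hy : y ∉ Ico (0 : ℝ) 1 := by rw [← hmaps, ← hxy, hmaps]; exact hx
        rwa [hout x hx, hout y hy] at hxy
    · intro y
      by_cases hy : y ∈ Ico (0 : ℝ) 1
      · obtain ⟨x, _, hx⟩ := hbij.surjOn hy
        exact ⟨x, hx⟩
      · exact ⟨y, hout y hy⟩
  have hpiece : ∀ x ∈ Ico (0 : ℝ) 1, ∃ i : Fin k, x ∈ Ico (β i.castSucc) (β i.succ) := by
    intro x hx
    have : ∀ j : Fin (k + 1), x < β j → ∃ i : Fin k, x ∈ Ico (β i.castSucc) (β i.succ) := by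
      intro j
      induction j using Fin.induction with
      | zero => intro h; rw [hβ0] at h; exact absurd hx.1 (not_le.2 h)
      | succ j ih =>
        intro h
        by_cases hlt : x < β j.castSucc
        · exact ih hlt
        · exact ⟨j, not_lt.1 hlt, h⟩
    exact this (Fin.last k) (by rw [hβ1]; exact hx.2)
  refine ⟨Equiv.ofBijective S hB, fun x => rfl, ?_, ?_, hmaps⟩
  · intro x
    change ∀ᶠ y in 𝓝[>] x, S y = y + (S x - x)
    by_cases hx : x ∈ Ico (0 : ℝ) 1
    · obtain ⟨i, hi⟩ := hpiece x hx
      obtain ⟨c, hc⟩ := hpc i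
      filter_upwards [Ioo_mem_nhdsGT hi.2] with y hy
      rw [hc x hi, hc y ⟨hi.1.trans hy.1.le, hy.2⟩]; ring
    · rw [hout x hx]
      rcases lt_or_ge x 0 with h0 | h0
      · filter_upwards [Ioo_mem_nhdsGT h0] with y hy
        rw [hout y fun h => absurd hy.2 (not_lt.2 h.1)]; ring
      · have h1 : 1 ≤ x := by
          by_contra hn; exact hx ⟨h0, not_le.1 hn⟩
        filter_upwards [self_mem_nhdsWithin] with y hy
        rw [hout y fun h => absurd h.2 (not_lt.2 (h1.trans (le_of_lt hy)))]; ring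
  · refine (Set.finite_range β).subset ?_
    intro x hx
    by_contra hxβ
    apply hx
    change ∀ᶠ y in 𝓝[<] x, S y = y + (S x - x)
    by_cases hxI : x ∈ Ico (0 : ℝ) 1
    · obtain ⟨i, hi⟩ := hpiece x hxI
      obtain ⟨c, hc⟩ := hpc i
      have hlt : β i.castSucc < x := lt_of_le_of_ne hi.1 fun h => hxβ ⟨_, h⟩
      filter_upwards [Ioo_mem_nhdsLT hlt] with y hy
      rw [hc x hi, hc y ⟨hy.1.le, hy.2.trans hi.2⟩]; ring
    · rw [hout x hxI]
      rcases lt_or_ge x 0 with h0 | h0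
      · filter_upwards [self_mem_nhdsWithin] with y hy
        rw [hout y fun h => absurd h.1 (not_le.2 (lt_trans hy h0))]; ring
      · have h1 : 1 ≤ x := by
          by_contra hn; exact hxI ⟨h0, not_le.1 hn⟩
        have h1' : 1 < x := lt_of_le_of_ne h1 fun h => hxβ ⟨_, hβ1.trans h⟩
        filter_upwards [Ioo_mem_nhdsLT h1'] with y hy
        rw [hout y fun h => absurd hy.1 (not_lt.2 h.2.le)]; ring

/-- Rationally independent lengths give interval exchanges without roots. -/
theorem no_root_of_indep {m : ℕ} (hm : 3 ≤ m) (π : Equiv.Perm (Fin m))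
    (hsep : Separating π) (hirr : IrreduciblePerm π) (lam : Fin m → ℝ)
    (hpos : ∀ i, 0 < lam i) (hsum : ∑ i, lam i = 1) (hli : LinearIndependent ℚ lam) :
    ¬ HasNontrivialRoot (ietMap π lam) := by
  rintro ⟨S, n, hS, hn, hST⟩
  obtain ⟨σ, hσ, hrc, hfin, hmaps⟩ := iet_perm hS
  have hT : ∀ x, (σ ^ n) x = ietMap π lam x := by
    intro x
    rw [← hST]
    have : (σ : ℝ → ℝ) = S := funext hσ
    rw [← this, Equiv.Perm.iterate_eq_pow]
  have hsys := sys_of_iet hm hirr hpos hsum hli hT (maps_pow hmaps n) (hrc.pow n)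
  set z : Fin m := ⟨0, by omega⟩ with hz
  set i0 := π.symm z with hi0
  obtain ⟨i, hiz, hii⟩ : ∃ i : Fin m, i ≠ z ∧ i ≠ i0 := by
    by_contra hc
    push Not at hc
    have : (Finset.univ : Finset (Fin m)) ⊆ {z, i0} := by
      intro i _
      simp only [Finset.mem_insert, Finset.mem_singleton]
      by_cases h : i = z
      · exact Or.inl h
      · exact Or.inr (hc i h)
    have := (Finset.card_le_card this).trans Finset.card_le_two
    simp at this
    omega
  have hi0' : (i : ℕ) ≠ 0 := fun h => hiz (Fin.ext h)
  have hπi : (π i : ℕ) ≠ 0 := by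
    intro h
    apply hii
    rw [hi0, Equiv.eq_symm_apply]
    exact Fin.ext h
  refine hsys.no_root hrc hfin hmaps hn rfl (β := betaPt lam i) (β₀ := betaPt lam i0)
    ⟨i, rfl⟩ ?_ ⟨i0, rfl⟩ ?_ ?_ (fun M hM => singular hm hsep hpos hsum hT hsys hi0' hπi M hM)
    (m := m) (by omega) ?_ lam hli ?_
  · intro h
    exact hiz (betaPt_inj hpos (by rw [h]; exact (betaPt_zero lam).symm))
  · intro h; exact hii (betaPt_inj hpos h)
  · rw [T_beta hpos hT, hi0, Equiv.apply_symm_apply]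
    exact betaPt_zero _
  · rw [← Set.image_univ]
    refine (Set.ncard_image_le Set.finite_univ).trans ?_
    simp [Set.ncard_univ]
  · intro a
    refine ⟨_, ⟨a, rfl⟩, betaPt lam ((a : ℕ) + 1), ?_, ?_, ?_⟩
    · by_cases h : (a : ℕ) + 1 < m
      · exact Or.inr ⟨⟨a + 1, h⟩, rfl⟩
      · left
        have : (a : ℕ) + 1 = m := by have := a.2; omega
        rw [this, betaPt_top hsum]
    · exact betaPt_mono hpos (Nat.le_succ _)
    · simp only [betaPt_succ]; ring

/-! ### Genericity of rationally independent length vectors -/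

lemma exists_relation {m : ℕ} {lam : Fin m → ℝ} (h : ¬ LinearIndependent ℚ lam) :
    ∃ q : Fin m → ℚ, q ≠ 0 ∧ ∑ i, (q i : ℝ) * lam i = 0 := by
  obtain ⟨g, hg, i, hi⟩ := Fintype.not_linearIndependent_iff.1 h
  refine ⟨g, fun h0 => hi (by rw [h0]; rfl), ?_⟩
  simpa only [Rat.smul_def] using hg

lemma dense_relation {m : ℕ} (q : Fin m → ℚ) (hq : q ≠ 0) :
    Dense {lam : ↥(simplexSet m) | ∑ i, (q i : ℝ) * lam.1 i ≠ 0} := by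
  intro lam
  by_cases h0 : ∑ i, (q i : ℝ) * lam.1 i = 0
  swap
  · exact subset_closure h0
  obtain ⟨hpos, hsum⟩ := lam.2
  obtain ⟨i, j, hij⟩ : ∃ i j, q i ≠ q j := by
    by_contra hc
    push Not at hc
    apply hq
    ext i
    have : ∑ k, (q k : ℝ) * lam.1 k = q i := by
      rw [Finset.sum_congr rfl fun k _ => by rw [hc k i], ← Finset.mul_sum, hsum, mul_one]
    rw [this] at h0
    simpa using h0
  have hne : i ≠ j := fun h => hij (by rw [h])
  rw [closure_subtype]
  set v : Fin m → ℝ := Pi.single i 1 - Pi.single j 1 with hv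
  have hF : Continuous fun t : ℝ => lam.1 + t • v := by fun_prop
  have ht : Tendsto (fun t : ℝ => lam.1 + t • v) (𝓝[≠] 0) (𝓝 lam.1) := by
    have := hF.tendsto 0
    simp only [zero_smul, add_zero] at this
    exact this.mono_left nhdsWithin_le_nhds
  have hvs : ∑ k, v k = 0 := by
    simp [hv, Finset.sum_sub_distrib]
  have hvq : ∑ k, (q k : ℝ) * v k = q i - q j := by
    simp [hv, mul_sub, Finset.sum_sub_distrib, Pi.single_apply]
  refine mem_closure_of_tendsto ht ?_
  have hev : ∀ᶠ t in 𝓝[≠] (0 : ℝ), ∀ k, 0 < (lam.1 + t • v) k := by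
    rw [Filter.eventually_all]
    intro k
    exact ((tendsto_pi_nhds.1 ht) k).eventually (lt_mem_nhds (hpos k))
  filter_upwards [hev, self_mem_nhdsWithin] with t htp ht0
  have hmem : lam.1 + t • v ∈ simplexSet m := by
    refine ⟨htp, ?_⟩
    simp only [Pi.add_apply, Pi.smul_apply, smul_eq_mul, Finset.sum_add_distrib, hsum,
      ← Finset.mul_sum, hvs, mul_zero, add_zero]
  refine ⟨⟨_, hmem⟩, ?_, rfl⟩
  have e : ∑ k, (q k : ℝ) * (lam.1 + t • v) k = t * (q i - q j) := by
    have : ∀ k, (q k : ℝ) * (lam.1 + t • v) k = q k * lam.1 k + t * (q k * v k) := by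
      intro k; simp only [Pi.add_apply, Pi.smul_apply, smul_eq_mul]; ring
    simp only [this, Finset.sum_add_distrib, h0, zero_add, ← Finset.mul_sum, hvq]
  simp only [Set.mem_ofPred_eq, e]
  refine mul_ne_zero ht0 ?_
  rw [sub_ne_zero]
  exact_mod_cast hij

lemma chart_sum {k : ℕ} (q : Fin (k + 1) → ℚ) (x : Fin k → ℝ) :
    ∑ i, (q i : ℝ) * chartMap (k + 1) x i
      = q (Fin.last k) + ∑ j : Fin k, ((q j.castSucc : ℝ) - q (Fin.last k)) * x j := by
  have h1 : ∀ j : Fin k, chartMap (k + 1) x j.castSucc = x j := by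
    intro j; simp [chartMap]
  have h2 : chartMap (k + 1) x (Fin.last k) = 1 - ∑ j, x j := by
    simp [chartMap]
  rw [Fin.sum_univ_castSucc, h2]
  simp only [h1, sub_mul, Finset.sum_sub_distrib, ← Finset.mul_sum]
  ring

lemma null_relation {k : ℕ} (q : Fin (k + 1) → ℚ) (hq : q ≠ 0) :
    volume {x : Fin k → ℝ | ∑ i, (q i : ℝ) * chartMap (k + 1) x i = 0} = 0 := by
  let s : AffineSubspace ℝ (Fin k → ℝ) :=
    { carrier := {x | ∑ i, (q i : ℝ) * chartMap (k + 1) x i = 0}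
      smul_vsub_vadd_mem' := by
        intro c p1 p2 p3 h1 h2 h3
        simp only [Set.mem_ofPred_eq, chart_sum] at *
        have : ∑ j : Fin k, ((q j.castSucc : ℝ) - q (Fin.last k)) * (c • (p1 -ᵥ p2) +ᵥ p3) j
            = c * (∑ j : Fin k, ((q j.castSucc : ℝ) - q (Fin.last k)) * p1 j
              - ∑ j : Fin k, ((q j.castSucc : ℝ) - q (Fin.last k)) * p2 j)
              + ∑ j : Fin k, ((q j.castSucc : ℝ) - q (Fin.last k)) * p3 j := by
          rw [← Finset.sum_sub_distrib, Finset.mul_sum, ← Finset.sum_add_distrib]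
          refine Finset.sum_congr rfl fun j _ => ?_
          simp
          ring
        rw [this]
        have e : (∑ j : Fin k, ((q j.castSucc : ℝ) - q (Fin.last k)) * p1 j
              - ∑ j : Fin k, ((q j.castSucc : ℝ) - q (Fin.last k)) * p2 j) = 0 := by linarith
        rw [e]
        linarith }
  refine Measure.addHaar_affineSubspace volume s ?_
  intro htop
  have hall : ∀ x : Fin k → ℝ, ∑ i, (q i : ℝ) * chartMap (k + 1) x i = 0 := by
    intro x
    have : x ∈ s := by rw [htop]; exact AffineSubspace.mem_top ℝ _ x
    exact this
  have hl : (q (Fin.last k) : ℝ) = 0 := by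
    have := hall 0
    rw [chart_sum] at this
    simpa using this
  apply hq
  ext i
  refine Fin.lastCases ?_ (fun j => ?_) i
  · exact_mod_cast hl
  · have := hall (Pi.single j 1)
    rw [chart_sum, hl] at this
    simpa [Pi.single_apply] using this

theorem stmt8 {m : ℕ} (hm : 3 ≤ m) (π : Equiv.Perm (Fin m))
    (hsep : Separating π) (hirr : IrreduciblePerm π) :
    ({lam : ↥(simplexSet m) | ¬ HasNontrivialRoot (ietMap π lam.1)} ∈
        residual ↥(simplexSet m)) ∧
    MeasureTheory.volume {x : Fin (m - 1) → ℝ |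
        chartMap m x ∈ simplexSet m ∧ HasNontrivialRoot (ietMap π (chartMap m x))} = 0 := by
  have main : ∀ lam ∈ simplexSet m, HasNontrivialRoot (ietMap π lam) →
      ∃ q : Fin m → ℚ, q ≠ 0 ∧ ∑ i, (q i : ℝ) * lam i = 0 := by
    intro lam hlam hroot
    apply exists_relation
    intro hli
    exact no_root_of_indep hm π hsep hirr lam hlam.1 hlam.2 hli hroot
  constructor
  · have h1 : ∀ q : {q : Fin m → ℚ // q ≠ 0},
        {lam : ↥(simplexSet m) | ∑ i, (q.1 i : ℝ) * lam.1 i ≠ 0} ∈ residual ↥(simplexSet m) := by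
      intro q
      refine residual_of_dense_open ?_ (dense_relation q.1 q.2)
      refine isOpen_ne_fun ?_ continuous_const
      exact continuous_finsetSum _ fun i _ =>
        continuous_const.mul ((continuous_apply i).comp continuous_subtype_val)
    filter_upwards [countable_iInter_mem.2 h1] with lam hlam hroot
    obtain ⟨q, hq, hrel⟩ := main lam.1 lam.2 hroot
    exact Set.mem_iInter.1 hlam ⟨q, hq⟩ hrel
  · obtain ⟨k, rfl⟩ : ∃ k, m = k + 1 := ⟨m - 1, by omega⟩
    have h2 : MeasureTheory.volume (⋃ q : {q : Fin (k + 1) → ℚ // q ≠ 0},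
        {x : Fin k → ℝ | ∑ i, (q.1 i : ℝ) * chartMap (k + 1) x i = 0}) = 0 :=
      MeasureTheory.measure_iUnion_null fun q => null_relation q.1 q.2
    refine MeasureTheory.measure_mono_null ?_ h2
    rintro x ⟨hx, hroot⟩
    obtain ⟨q, hq, hrel⟩ := main _ hx hroot
    exact Set.mem_iUnion.2 ⟨⟨q, hq⟩, hrel⟩


end IETRoots
end

section
/- For every m ≥ 2 there exists a minimal m-interval exchange transformation T defined by a separating permutation such that rank(T) = 1 + ⌊m/2⌋ and T has an n-th root in 𝔾 for some n ≥ 2. (Hence the bound rank(T) ≤ 1 + ⌊m/2⌋ for minimal m-IETs with separating permutation admitting nontrivial roots is optimal.) -/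
open Set

namespace IETRoots

theorem exists_nat_fract_mem {θ : ℝ} (hθ : Irrational θ) (u l r : ℝ) (hl : 0 ≤ l) (hlr : l < r)
    (hr : r ≤ 1) : ∃ q : ℕ, Int.fract (u + q * θ) ∈ Set.Ioo l r := by
  have h1 : DenseRange (fun n : ℤ => n • (θ : AddCircle (1:ℝ))) := by
    have := (AddCircle.denseRange_zsmul_coe_iff (a := θ) (p := 1)).2 (by simpa using hθ)
    simpa using this
  have h2 : DenseRange (fun n : ℕ => n • (θ : AddCircle (1:ℝ))) := denseRange_zsmul_iff_nsmul.1 h1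
  have ho : IsOpen ((fun z : ℝ => (z : AddCircle (1:ℝ))) '' Set.Ioo (l - u) (r - u)) :=
    QuotientAddGroup.isOpenMap_coe _ isOpen_Ioo
  obtain ⟨q, z, hz, hq⟩ := h2.exists_mem_open ho
    (Set.Nonempty.image _ (Set.nonempty_Ioo.2 (by linarith)))
  refine ⟨q, ?_⟩
  have h3 : ((q * θ - z : ℝ) : AddCircle (1:ℝ)) = 0 := by
    have : ((q * θ : ℝ) : AddCircle (1:ℝ)) = q • (θ : AddCircle (1:ℝ)) := by
      rw [← AddCircle.coe_nsmul]; simp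
    rw [AddCircle.coe_sub, this]; simp only at hq; rw [hq]; simp
  obtain ⟨n, hn⟩ := (AddCircle.coe_eq_zero_iff (1:ℝ)).1 h3
  have h4 : u + q * θ = (u + z) + n := by
    have : (n : ℝ) = q * θ - z := by simpa using hn
    linarith
  rw [h4, Int.fract_add_intCast, Int.fract_eq_self.2 ⟨by linarith [hz.1], by linarith [hz.2]⟩]
  exact ⟨by linarith [hz.1], by linarith [hz.2]⟩

/-- The point of block `k mod N` with (scaled) circle coordinate `y`. -/
noncomputable def pt (N k : ℕ) (y : ℝ) : ℝ := (((k % N : ℕ) : ℝ) + Int.fract y) / N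

/-- The model map: block `k` goes to block `k+1`, rotated by `c k`. -/
noncomputable def modelMap (N : ℕ) (c : ℕ → ℝ) (x : ℝ) : ℝ :=
  open Classical in
  if x ∈ unitI then pt N (⌊(N:ℝ) * x⌋₊ + 1) (N * x + c ⌊(N:ℝ) * x⌋₊) else x

theorem pt_mem {N : ℕ} (hN : 0 < N) (k : ℕ) (y : ℝ) : pt N k y ∈ unitI := by
  have hN' : (0:ℝ) < N := by exact_mod_cast hN
  have h1 : ((k % N : ℕ) : ℝ) + 1 ≤ N := by exact_mod_cast Nat.mod_lt k hN
  have h2 := Int.fract_nonneg y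
  have h3 := Int.fract_lt_one y
  refine ⟨by unfold pt; positivity, ?_⟩
  unfold pt
  rw [div_lt_one hN']; linarith

theorem mul_pt {N : ℕ} (hN : 0 < N) (k : ℕ) (y : ℝ) :
    (N:ℝ) * pt N k y = ((k % N : ℕ) : ℝ) + Int.fract y := by
  have hN' : (N:ℝ) ≠ 0 := by positivity
  unfold pt; field_simp

theorem floor_mul_pt {N : ℕ} (hN : 0 < N) (k : ℕ) (y : ℝ) : ⌊(N:ℝ) * pt N k y⌋₊ = k % N := by
  rw [mul_pt hN, Nat.floor_eq_iff (by have := Int.fract_nonneg y; positivity)]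
  exact ⟨by linarith [Int.fract_nonneg y], by linarith [Int.fract_lt_one y]⟩

theorem pt_congr {N k k' : ℕ} {y y' : ℝ} (hk : k % N = k' % N) (hy : Int.fract y = Int.fract y') :
    pt N k y = pt N k' y' := by
  unfold pt; rw [hk, hy]

theorem exists_pt {N : ℕ} (hN : 0 < N) {x : ℝ} (hx : x ∈ unitI) :
    x = pt N ⌊(N:ℝ) * x⌋₊ (N * x) := by
  have hN' : (0:ℝ) < N := by exact_mod_cast hN
  have h0 : 0 ≤ (N:ℝ) * x := mul_nonneg hN'.le hx.1
  have h1 : ⌊(N:ℝ) * x⌋₊ < N := by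
    rw [Nat.floor_lt h0]; nlinarith [hx.2]
  unfold pt
  rw [Nat.mod_eq_of_lt h1, natCast_floor_eq_intCast_floor h0, Int.floor_add_fract]
  field_simp

theorem modelMap_pt {N : ℕ} (hN : 0 < N) (c : ℕ → ℝ) (k : ℕ) (y : ℝ) :
    modelMap N c (pt N k y) = pt N (k + 1) (y + c (k % N)) := by
  unfold modelMap
  rw [if_pos (pt_mem hN k y), floor_mul_pt hN, mul_pt hN]
  apply pt_congr
  · simp
  · rw [Int.fract_eq_fract]
    refine ⟨((k % N : ℕ) : ℤ) - ⌊y⌋, ?_⟩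
    have := Int.floor_add_fract y
    rw [Int.cast_sub, Int.cast_natCast]
    linarith

theorem modelMap_iter {N : ℕ} (hN : 0 < N) (c : ℕ → ℝ) (k : ℕ) (y : ℝ) (n : ℕ) :
    (modelMap N c)^[n] (pt N k y) = pt N (k + n) (y + ∑ l ∈ Finset.range n, c ((k + l) % N)) := by
  induction n with
  | zero => simp
  | succ n ih =>
    rw [Function.iterate_succ_apply', ih, modelMap_pt hN, Finset.sum_range_succ]
    congr 1
    ring

theorem sum_period {N : ℕ} (_ : 0 < N) (c : ℕ → ℝ) (k : ℕ) :
    ∑ l ∈ Finset.range N, c ((k + l) % N) = ∑ l ∈ Finset.range N, c l := by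
  induction k with
  | zero =>
    apply Finset.sum_congr rfl
    intro l hl
    rw [zero_add, Nat.mod_eq_of_lt (Finset.mem_range.1 hl)]
  | succ k ih =>
    rw [← ih]
    have h1 := Finset.sum_range_succ (fun l => c ((k + l) % N)) N
    have h2 := Finset.sum_range_succ' (fun l => c ((k + l) % N)) N
    simp only [Nat.add_mod_right, add_zero] at h1 h2
    have h3 : ∀ l, c ((k + 1 + l) % N) = c ((k + (l + 1)) % N) := fun l => by
      congr 2; ring
    simp only [h3]
    linarith

theorem modelMap_iter_period {N : ℕ} (hN : 0 < N) (c : ℕ → ℝ) (k : ℕ) (y : ℝ) (q : ℕ) :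
    (modelMap N c)^[N * q] (pt N k y) = pt N k (y + q * ∑ l ∈ Finset.range N, c l) := by
  induction q with
  | zero => simp
  | succ q ih =>
    rw [Nat.mul_succ, Nat.add_comm, Function.iterate_add_apply, ih, modelMap_iter hN,
      sum_period hN]
    apply pt_congr
    · simp
    · congr 1; push_cast; ring

theorem modelMap_minimal {N : ℕ} (hN : 0 < N) (c : ℕ → ℝ)
    (hc : Irrational (∑ l ∈ Finset.range N, c l)) : IsMinimal (modelMap N c) := by
  intro x hx z hz
  have hN' : (0:ℝ) < N := by exact_mod_cast hN
  rw [Metric.mem_closure_iff]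
  intro ε hε
  rw [exists_pt hN hx, exists_pt hN hz]
  set k := ⌊(N:ℝ) * x⌋₊
  set k' := ⌊(N:ℝ) * z⌋₊
  set y := (N:ℝ) * x
  set w := (N:ℝ) * z
  have hw0 := Int.fract_nonneg w
  have hw1 := Int.fract_lt_one w
  -- number of steps to reach the right block
  set r := k' + (N * k - k) with hr
  have hk : k ≤ N * k := Nat.le_mul_of_pos_left _ hN
  have hkr : (k + r) % N = k' % N := by
    have : k + r = k' + N * k := by omega
    rw [this]; simp
  obtain ⟨q, hq⟩ := exists_nat_fract_mem hc (y + ∑ l ∈ Finset.range r, c ((k + l) % N))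
    (Int.fract w) (min 1 (Int.fract w + N * ε)) hw0
    (lt_min hw1 (by have := mul_pos hN' hε; linarith)) (min_le_left _ _)
  refine ⟨pt N (k + r) ((y + ∑ l ∈ Finset.range r, c ((k + l) % N)) +
    q * ∑ l ∈ Finset.range N, c l), ⟨N * q + r, Or.inl ?_⟩, ?_⟩
  · rw [Function.iterate_add_apply, modelMap_iter hN, modelMap_iter_period hN]
  · unfold pt
    rw [hkr, Real.dist_eq, abs_lt]
    have h2 := lt_of_lt_of_le hq.2 (min_le_right _ _)
    rw [← sub_div, lt_div_iff₀ hN', div_lt_iff₀ hN']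
    constructor
    · linarith
    · nlinarith [hq.1, mul_pos hN' hε]

theorem modelMap_root {N : ℕ} (hN : 0 < N) (c : ℕ → ℝ) :
    (modelMap N (fun k => c k - (∑ l ∈ Finset.range N, c l) / (N + 1)))^[N + 1]
      = modelMap N c := by
  funext x
  by_cases hx : x ∈ unitI
  · rw [exists_pt hN hx, modelMap_iter hN, modelMap_pt hN]
    apply pt_congr
    · rw [← Nat.add_assoc, Nat.add_right_comm]; simp
    · congr 1
      rw [Finset.sum_sub_distrib, Finset.sum_range_succ, sum_period hN]
      have : (N:ℝ) + 1 ≠ 0 := by positivity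
      simp
      field_simp
      ring
  · have h : ∀ c, modelMap N c x = x := fun c => by unfold modelMap; rw [if_neg hx]
    rw [h]
    exact Function.iterate_fixed (h _) _

theorem modelMap_bijOn {N : ℕ} (hN : 0 < N) (c : ℕ → ℝ) :
    Set.BijOn (modelMap N c) unitI unitI := by
  refine ⟨?_, ?_, ?_⟩
  · intro x hx
    rw [exists_pt hN hx, modelMap_pt hN]; exact pt_mem hN _ _
  · intro x hx x' hx' h
    rw [exists_pt hN hx, exists_pt hN hx', modelMap_pt hN, modelMap_pt hN] at h
    rw [exists_pt hN hx, exists_pt hN hx']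
    set k := ⌊(N:ℝ) * x⌋₊
    set k' := ⌊(N:ℝ) * x'⌋₊
    have h1 := congrArg (fun t => ⌊(N:ℝ) * t⌋₊) h
    simp only [floor_mul_pt hN] at h1
    have hk : k % N = k' % N := by
      have : k + 1 ≡ k' + 1 [MOD N] := h1
      exact Nat.ModEq.add_right_cancel' 1 this
    have h2 := congrArg (fun t => (N:ℝ) * t) h
    simp only [mul_pt hN, h1, hk] at h2
    have h3 := add_left_cancel h2
    apply pt_congr hk
    rw [Int.fract_eq_fract] at h3 ⊢
    obtain ⟨n, hn⟩ := h3
    exact ⟨n, by linarith⟩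
  · intro x hx
    set k := ⌊(N:ℝ) * x⌋₊
    refine ⟨pt N (k + (N - 1)) (N * x - c ((k + (N - 1)) % N)), pt_mem hN _ _, ?_⟩
    rw [modelMap_pt hN]
    refine Eq.trans (pt_congr ?_ ?_) (exists_pt hN hx).symm
    · rw [Nat.add_assoc, Nat.sub_add_cancel hN]; simp [k]
    · congr 1; ring

theorem lt_of_step {m : ℕ} {b : ℕ → ℝ} (hb : ∀ j < m, b j < b (j + 1)) {i k : ℕ} (hik : i < k)
    (hk : k ≤ m) : b i < b k := by
  induction k, hik using Nat.le_induction with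
  | base => exact hb i (by omega)
  | succ k hik ih => exact (ih (by omega)).trans (hb k (by omega))

theorem le_of_step {m : ℕ} {b : ℕ → ℝ} (hb : ∀ j < m, b j < b (j + 1)) {i k : ℕ} (hik : i ≤ k)
    (hk : k ≤ m) : b i ≤ b k := by
  rcases hik.lt_or_eq with h | rfl
  · exact (lt_of_step hb h hk).le
  · exact le_rfl

theorem lt_idx_of_step {m : ℕ} {b : ℕ → ℝ} (hb : ∀ j < m, b j < b (j + 1)) {i k : ℕ}
    (hi : i ≤ m) (h : b i < b k) : i < k := by
  by_contra hc
  exact absurd (le_of_step hb (not_lt.1 hc) hi) (not_le.2 h)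

theorem inj_of_step {m : ℕ} {b : ℕ → ℝ} (hb : ∀ j < m, b j < b (j + 1)) {i k : ℕ}
    (hi : i ≤ m) (hk : k ≤ m) (h : b i = b k) : i = k := by
  rcases lt_trichotomy i k with h' | h' | h'
  · exact absurd h (lt_of_step hb h' hk).ne
  · exact h'
  · exact absurd h (lt_of_step hb h' hi).ne'

theorem locate {m : ℕ} {b : ℕ → ℝ} {x : ℝ} (h0 : b 0 ≤ x) (h1 : x < b m) :
    ∃ j < m, x ∈ Set.Ico (b j) (b (j + 1)) := by
  induction m with
  | zero => exact absurd h0 (not_le.2 h1)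
  | succ m ih =>
    by_cases h : x < b m
    · obtain ⟨j, hj, hx⟩ := ih h
      exact ⟨j, by omega, hx⟩
    · exact ⟨m, by omega, not_lt.1 h, h1⟩

theorem sum_filter_tele {m : ℕ} (b : ℕ → ℝ) (h0 : b 0 = 0) {j : ℕ} (hj : j ≤ m) :
    ∑ i ∈ Finset.univ.filter (fun i : Fin m => (i : ℕ) < j), (b ((i : ℕ) + 1) - b i) = b j := by
  rw [Finset.sum_filter, Fin.sum_univ_eq_sum_range
    (fun i => if i < j then (b (i + 1) - b i) else 0) m, ← Finset.sum_filter]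
  have : (Finset.range m).filter (fun i => i < j) = Finset.range j := by
    ext i; simp; omega
  rw [this, Finset.sum_range_sub, h0, sub_zero]

theorem ietMap_apply {m : ℕ} (π : Equiv.Perm (Fin m)) (lam : Fin m → ℝ) (b b' : ℕ → ℝ)
    (hb : ∀ j < m, b j < b (j + 1)) (h0 : b 0 = 0) (h0' : b' 0 = 0)
    (hl : ∀ j, lam j = b ((j : ℕ) + 1) - b j)
    (hl' : ∀ j, lam j = b' ((π j : ℕ) + 1) - b' (π j))
    (j : Fin m) (x : ℝ) (hx : x ∈ Set.Ico (b j) (b ((j : ℕ) + 1))) :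
    ietMap π lam x = x - b j + b' (π j) := by
  have hB : ∀ j : Fin m, betaPt lam (j : ℕ) = b j := fun j => by
    unfold betaPt
    rw [Finset.sum_congr rfl (fun i _ => hl i)]
    exact sum_filter_tele b h0 j.2.le
  have hI : ∀ i : Fin m, x ∈ Set.Ico (betaPt lam (i : ℕ)) (betaPt lam (i : ℕ) + lam i) ↔
      x ∈ Set.Ico (b i) (b ((i : ℕ) + 1)) := fun i => by
    rw [hB, hl]; simp
  have hex : ∃ i : Fin m, x ∈ Set.Ico (betaPt lam (i : ℕ)) (betaPt lam (i : ℕ) + lam i) :=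
    ⟨j, (hI j).2 hx⟩
  have hch : hex.choose = j := by
    have h2 := (hI _).1 hex.choose_spec
    have h3 := lt_idx_of_step hb (hex.choose).2.le (h2.1.trans_lt hx.2)
    have h4 := lt_idx_of_step hb j.2.le (hx.1.trans_lt h2.2)
    apply Fin.ext; omega
  unfold ietMap
  rw [dif_pos hex, hch, hB]
  congr 1
  rw [Finset.sum_filter]
  rw [← sum_filter_tele b' h0' (π j).2.le, Finset.sum_filter]
  rw [← Equiv.sum_comp π
    (fun i : Fin m => if (i : ℕ) < (π j : ℕ) then b' ((i : ℕ) + 1) - b' i else 0)]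
  apply Finset.sum_congr rfl
  intro i _
  rw [hl' i]
  rfl

theorem ietMap_outside {m : ℕ} (π : Equiv.Perm (Fin m)) (lam : Fin m → ℝ) (b : ℕ → ℝ)
    (hb : ∀ j < m, b j < b (j + 1)) (h0 : b 0 = 0) (h1 : b m = 1)
    (hl : ∀ j, lam j = b ((j : ℕ) + 1) - b j) (x : ℝ) (hx : x ∉ unitI) :
    ietMap π lam x = x := by
  unfold ietMap
  rw [dif_neg]
  rintro ⟨j, hj⟩
  have hB : betaPt lam (j : ℕ) = b j := by
    unfold betaPt
    rw [Finset.sum_congr rfl (fun i _ => hl i)]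
    exact sum_filter_tele b h0 j.2.le
  rw [hB, hl] at hj
  apply hx
  have h2 := le_of_step hb (Nat.zero_le j) j.2.le
  have h3 := le_of_step hb j.2 le_rfl
  exact ⟨by linarith [hj.1], by linarith [hj.2]⟩

theorem discSet_eq {m : ℕ} (T : ℝ → ℝ) (b b' : ℕ → ℝ) (p : ℕ → ℕ)
    (hb : ∀ j < m, b j < b (j + 1)) (h0 : b 0 = 0) (h1 : b m = 1)
    (hb' : ∀ j < m, b' j < b' (j + 1))
    (hp : ∀ j < m, p j < m)
    (hlen : ∀ j < m, b (j + 1) - b j = b' (p j + 1) - b' (p j))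
    (hsep : ∀ j, j + 1 < m → p (j + 1) ≠ p j + 1)
    (hT : ∀ j < m, ∀ x ∈ Set.Ico (b j) (b (j + 1)), T x = x - b j + b' (p j)) :
    DiscSet T = {x | ∃ j, 0 < j ∧ j < m ∧ x = b j} := by
  ext x
  constructor
  · rintro ⟨hx, hd⟩
    obtain ⟨j, hj, hxj⟩ := locate (m := m) (b := b) (x := x) (by rw [h0]; exact hx.1)
      (by rw [h1]; exact hx.2)
    by_contra hno
    apply hd
    have hcont : ContinuousAt (fun x => x - b j + b' (p j)) x := by fun_prop
    have hmem : Set.Ico (b j) (b (j + 1)) ∈ nhdsWithin x unitI := by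
      rcases hxj.1.lt_or_eq with h | h
      · exact mem_nhdsWithin_of_mem_nhds (Ico_mem_nhds h hxj.2)
      · have hj0 : j = 0 := by
          by_contra hj0
          exact hno ⟨j, by omega, hj, h.symm⟩
        subst hj0
        have : Set.Iio (b (0 + 1)) ∈ nhdsWithin x unitI :=
          mem_nhdsWithin_of_mem_nhds (Iio_mem_nhds hxj.2)
        filter_upwards [this, self_mem_nhdsWithin] with z hz hz'
        exact ⟨by rw [h0]; exact hz'.1, hz⟩
    refine hcont.continuousWithinAt.congr_of_eventuallyEq ?_ (hT j hj x hxj)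
    filter_upwards [hmem] with z hz
    exact hT j hj z hz
  · rintro ⟨j, hj0, hj, rfl⟩
    obtain ⟨i, rfl⟩ : ∃ i, j = i + 1 := ⟨j - 1, by omega⟩
    refine ⟨⟨?_, ?_⟩, ?_⟩
    · rw [← h0]; exact (lt_of_step hb hj0 hj.le).le
    · rw [← h1]; exact lt_of_step hb hj le_rfl
    · intro hc
      have hlt := hb i (by omega)
      have hsub : Set.Ioo (b i) (b (i + 1)) ⊆ unitI := by
        intro z hz
        have h3 := le_of_step hb (Nat.zero_le i) (by omega)
        have h4 := le_of_step hb hj.le le_rfl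
        exact ⟨by linarith [hz.1], by linarith [hz.2]⟩
      have hne : (nhdsWithin (b (i + 1)) (Set.Ioo (b i) (b (i + 1)))).NeBot :=
        right_nhdsWithin_Ioo_neBot hlt
      have t1 : Filter.Tendsto T (nhdsWithin (b (i + 1)) (Set.Ioo (b i) (b (i + 1))))
          (nhds (T (b (i + 1)))) := hc.mono_left (nhdsWithin_mono _ hsub)
      have hcont : ContinuousAt (fun x => x - b i + b' (p i)) (b (i + 1)) := by fun_prop
      have t2 : Filter.Tendsto T (nhdsWithin (b (i + 1)) (Set.Ioo (b i) (b (i + 1))))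
          (nhds (b (i + 1) - b i + b' (p i))) := by
        refine (hcont.tendsto.mono_left nhdsWithin_le_nhds).congr' ?_
        filter_upwards [self_mem_nhdsWithin] with z hz
        exact (hT i (by omega) z ⟨hz.1.le, hz.2⟩).symm
      have h5 := tendsto_nhds_unique t1 t2
      rw [hT (i + 1) hj _ ⟨le_rfl, hb _ hj⟩, hlen i (by omega)] at h5
      have h6 : b' (p (i + 1)) = b' (p i + 1) := by linarith
      exact hsep i hj (inj_of_step hb' (hp _ hj).le (hp i (by omega)) h6)

theorem gapLengths_eq {m : ℕ} (hm : 0 < m) (T : ℝ → ℝ) (b : ℕ → ℝ)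
    (hb : ∀ j < m, b j < b (j + 1)) (h0 : b 0 = 0) (h1 : b m = 1)
    (hD : DiscSet T = {x | ∃ j, 0 < j ∧ j < m ∧ x = b j}) :
    gapLengths T = {l | ∃ j < m, l = b (j + 1) - b j} := by
  have hE : ∀ x, x ∈ endpointsOf T ↔ ∃ j ≤ m, x = b j := by
    intro x
    unfold endpointsOf
    rw [hD]
    simp only [Set.mem_insert_iff, Set.mem_ofPred_eq]
    constructor
    · rintro (rfl | rfl | ⟨j, _, hj, rfl⟩)
      · exact ⟨0, by omega, h0.symm⟩
      · exact ⟨m, le_rfl, h1.symm⟩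
      · exact ⟨j, hj.le, rfl⟩
    · rintro ⟨j, hj, rfl⟩
      rcases Nat.eq_zero_or_pos j with rfl | hj0
      · exact Or.inl h0
      · rcases hj.lt_or_eq with h | rfl
        · exact Or.inr (Or.inr ⟨j, hj0, h, rfl⟩)
        · exact Or.inr (Or.inl h1)
  ext l
  unfold gapLengths
  simp only [Set.mem_ofPred_eq, hE]
  constructor
  · rintro ⟨_, ⟨i, hi, rfl⟩, _, ⟨k, hk, rfl⟩, hlt, hno, rfl⟩
    have hik := lt_idx_of_step hb hi hlt
    have : k = i + 1 := by
      by_contra hne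
      exact hno (b (i + 1)) ⟨i + 1, by omega, rfl⟩
        ⟨hb i (by omega), lt_of_step hb (by omega) hk⟩
    subst this
    exact ⟨i, by omega, rfl⟩
  · rintro ⟨j, hj, rfl⟩
    refine ⟨_, ⟨j, hj.le, rfl⟩, _, ⟨j + 1, hj, rfl⟩, hb j hj, ?_, rfl⟩
    rintro _ ⟨i, hi, rfl⟩ ⟨h2, h3⟩
    have := lt_idx_of_step hb hj.le h2
    have := lt_idx_of_step hb hi h3
    omega

theorem exists_indep (h : ℕ) : ∃ c : ℕ → ℝ, (∀ i < h, 0 < c i ∧ c i < 1) ∧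
    (∀ i, h ≤ i → c i = 0) ∧
    ∀ (q : ℚ) (f : ℕ → ℚ), (q : ℝ) + ∑ l ∈ Finset.range h, (f l : ℝ) * c l = 0 →
      q = 0 ∧ ∀ l < h, f l = 0 := by
  let B := Module.Basis.ofVectorSpace ℚ ℝ
  have hinf : Infinite (Module.Basis.ofVectorSpaceIndex ℚ ℝ) := by
    by_contra hfin
    rw [not_infinite_iff_finite] at hfin
    have : Module.Finite ℚ ℝ := Module.Finite.of_basis B
    have h1 := Module.rank_lt_aleph0 ℚ ℝ
    rw [Real.rank_rat_real] at h1
    exact absurd Cardinal.aleph0_le_continuum (not_le.2 h1)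
  let e := Infinite.natEmbedding (Module.Basis.ofVectorSpaceIndex ℚ ℝ)
  let v : ℕ → ℝ := fun n => B (e n)
  have hv : LinearIndependent ℚ v := B.linearIndependent.comp e e.injective
  have hv0 : v 0 ≠ 0 := hv.ne_zero 0
  have key : ∀ (q : ℚ) (f : ℕ → ℚ),
      (q : ℝ) + ∑ l ∈ Finset.range h, (f l : ℝ) * (v (l + 1) / v 0) = 0 →
      q = 0 ∧ ∀ l < h, f l = 0 := by
    intro q f hq
    have h1 := linearIndependent_iff'.1 hv (Finset.range (h + 1))
      (fun n => if n = 0 then q else f (n - 1)) (by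
        rw [Finset.sum_range_succ']
        have h2 : ((q : ℝ) + ∑ l ∈ Finset.range h, (f l : ℝ) * (v (l + 1) / v 0)) * v 0 = 0 := by
          rw [hq, zero_mul]
        rw [add_mul, Finset.sum_mul] at h2
        have h3 : ∀ l, (f l : ℝ) * (v (l + 1) / v 0) * v 0 = (f l : ℝ) * v (l + 1) := fun l => by
          field_simp
        simp only [h3] at h2
        simp [Rat.smul_def]
        linarith)
    refine ⟨by simpa using h1 0 (by simp), fun l hl => ?_⟩
    simpa using h1 (l + 1) (by simpa using hl)
  have key2 : ∀ (q : ℚ) (f : ℕ → ℚ),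
      (q : ℝ) + ∑ l ∈ Finset.range h, (f l : ℝ) * Int.fract (v (l + 1) / v 0) = 0 →
      q = 0 ∧ ∀ l < h, f l = 0 := by
    intro q f hq
    have h1 := key (q - ∑ l ∈ Finset.range h, f l * ⌊v (l + 1) / v 0⌋) f (by
      rw [← hq]
      push_cast
      have : ∀ l, (f l : ℝ) * Int.fract (v (l + 1) / v 0) =
        (f l : ℝ) * (v (l + 1) / v 0) - f l * ⌊v (l + 1) / v 0⌋ := fun l => by
          rw [Int.fract]; ring
      simp only [this, Finset.sum_sub_distrib]
      ring)
    refine ⟨?_, h1.2⟩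
    have h2 := h1.1
    rwa [Finset.sum_eq_zero (fun l hl => by rw [h1.2 l (Finset.mem_range.1 hl), zero_mul]),
      sub_zero] at h2
  refine ⟨fun i => if i < h then Int.fract (v (i + 1) / v 0) else 0, ?_, ?_, ?_⟩
  · intro i hi
    simp only [if_pos hi]
    refine ⟨(Int.fract_nonneg _).lt_of_ne ?_, Int.fract_lt_one _⟩
    intro h0
    have := (key2 0 (fun l => if l = i then 1 else 0) (by
      rw [Finset.sum_eq_zero]
      · simp
      · intro l _
        by_cases hli : l = i
        · subst hli; rw [← h0, mul_zero]
        · simp [hli])).2 i hi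
    simp at this
  · intro i hi
    simp [not_lt.2 hi]
  · intro q f hq
    apply key2
    rw [← hq]
    congr 1
    apply Finset.sum_congr rfl
    intro l hl
    simp [Finset.mem_range.1 hl]

/-- Cut points of the model map. -/
noncomputable def bb (N : ℕ) (c : ℕ → ℝ) (j : ℕ) : ℝ :=
  if j % 2 = 0 then ((j / 2 : ℕ) : ℝ) / N else (((j / 2 : ℕ) : ℝ) + 1 - c (j / 2)) / N

theorem bb_even (N : ℕ) (c : ℕ → ℝ) (i : ℕ) : bb N c (2 * i) = (i : ℝ) / N := by
  unfold bb; simp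

theorem bb_odd (N : ℕ) (c : ℕ → ℝ) (i : ℕ) : bb N c (2 * i + 1) = ((i : ℝ) + 1 - c i) / N := by
  have h1 : (2 * i + 1) / 2 = i := by omega
  have h2 : (2 * i + 1) % 2 = 1 := by omega
  unfold bb; rw [h1, h2]; simp

theorem bb_even' (N : ℕ) (c : ℕ → ℝ) (i : ℕ) : bb N c (2 * i + 1 + 1) = ((i : ℝ) + 1) / N := by
  have := bb_even N c (i + 1)
  push_cast at this
  rw [← this]; rfl

theorem floor_block {N i : ℕ} (hN : 0 < N) (hi : i < N) {x : ℝ} (h1 : (i : ℝ) / N ≤ x)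
    (h2 : x < ((i : ℝ) + 1) / N) : x ∈ unitI ∧ ⌊(N:ℝ) * x⌋₊ = i := by
  have hN' : (0:ℝ) < N := by exact_mod_cast hN
  have hi' : (i:ℝ) + 1 ≤ N := by exact_mod_cast hi
  have h0 : (0:ℝ) ≤ i / N := by positivity
  have h3 : ((i:ℝ) + 1) / N ≤ 1 := by rw [div_le_one hN']; exact hi'
  rw [div_le_iff₀ hN'] at h1
  have h2' := h2
  rw [lt_div_iff₀ hN'] at h2
  refine ⟨⟨by nlinarith [Nat.cast_nonneg (α := ℝ) i], by linarith⟩, ?_⟩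
  rw [Nat.floor_eq_iff (by nlinarith [Nat.cast_nonneg (α := ℝ) i])]
  constructor <;> linarith

theorem modelMap_A {N i : ℕ} (hN : 0 < N) (hi : i < N) (c : ℕ → ℝ) (hc : 0 ≤ c i) {x : ℝ}
    (h1 : (i : ℝ) / N ≤ x) (h2 : x < ((i : ℝ) + 1 - c i) / N) :
    modelMap N c x = x - (i : ℝ) / N + ((((i + 1) % N : ℕ) : ℝ) + c i) / N := by
  have hN' : (0:ℝ) < N := by exact_mod_cast hN
  obtain ⟨hx, hf⟩ := floor_block hN hi h1 (h2.trans_le (by gcongr; linarith))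
  unfold modelMap
  rw [if_pos hx, hf]
  rw [div_le_iff₀ hN'] at h1
  rw [lt_div_iff₀ hN'] at h2
  have h3 : Int.fract ((N:ℝ) * x + c i) = N * x + c i - i := by
    rw [Int.fract_eq_iff]
    exact ⟨by linarith, by linarith, i, by push_cast; ring⟩
  unfold pt
  rw [h3]
  field_simp
  ring

theorem modelMap_B {N i : ℕ} (hN : 0 < N) (hi : i < N) (c : ℕ → ℝ) (hc : c i ≤ 1) {x : ℝ}
    (h1 : ((i : ℝ) + 1 - c i) / N ≤ x) (h2 : x < ((i : ℝ) + 1) / N) :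
    modelMap N c x = x - ((i : ℝ) + 1 - c i) / N + (((i + 1) % N : ℕ) : ℝ) / N := by
  have hN' : (0:ℝ) < N := by exact_mod_cast hN
  obtain ⟨hx, hf⟩ := floor_block hN hi (le_trans (by gcongr; linarith) h1) h2
  unfold modelMap
  rw [if_pos hx, hf]
  rw [div_le_iff₀ hN'] at h1
  rw [lt_div_iff₀ hN'] at h2
  have h3 : Int.fract ((N:ℝ) * x + c i) = N * x + c i - i - 1 := by
    rw [Int.fract_eq_iff]
    exact ⟨by linarith, by linarith, i + 1, by push_cast; ring⟩
  unfold pt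
  rw [h3]
  field_simp
  ring

theorem modelMap_isIET {N : ℕ} (hN : 0 < N) (s : ℕ → ℝ) (hs : ∀ k < N, Int.fract (s k) ≠ 0) :
    IsIET (modelMap N s) := by
  have hN' : (0:ℝ) < N := by exact_mod_cast hN
  refine ⟨modelMap_bijOn hN s, fun x hx => by unfold modelMap; rw [if_neg hx], ?_⟩
  have hfr : modelMap N s = modelMap N (fun k => Int.fract (s k)) := by
    funext x
    unfold modelMap
    split_ifs
    · apply pt_congr rfl
      rw [Int.fract_eq_fract]
      refine ⟨⌊s ⌊(N:ℝ) * x⌋₊⌋, ?_⟩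
      have := Int.floor_add_fract (s ⌊(N:ℝ) * x⌋₊)
      linarith
    · rfl
  rw [hfr]
  set c : ℕ → ℝ := fun k => Int.fract (s k)
  have hc0 : ∀ k < N, 0 < c k := fun k hk => (Int.fract_nonneg _).lt_of_ne (hs k hk).symm
  have hc1 : ∀ k, c k < 1 := fun k => Int.fract_lt_one _
  have hb : ∀ j < 2 * N, bb N c j < bb N c (j + 1) := by
    intro j hj
    rcases Nat.even_or_odd' j with ⟨i, rfl | rfl⟩
    · rw [bb_even, bb_odd]; gcongr; linarith [hc1 i]
    · rw [bb_odd, bb_even']; gcongr; linarith [hc0 i (by omega)]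
  refine ⟨2 * N, fun j => bb N c j, ?_, ?_, ?_, ?_⟩
  · intro i j hij
    exact lt_of_step hb hij (by omega)
  · simpa using bb_even N c 0
  · have := bb_even N c N
    simpa [hN'.ne'] using this
  · rintro ⟨j, hj⟩
    simp only [Fin.val_castSucc, Fin.val_succ]
    rcases Nat.even_or_odd' j with ⟨i, rfl | rfl⟩
    · refine ⟨- ((i : ℝ) / N) + ((((i + 1) % N : ℕ) : ℝ) + c i) / N, ?_⟩
      rw [bb_even, bb_odd]
      intro x hx
      rw [modelMap_A hN (by omega) c (hc0 i (by omega)).le hx.1 hx.2]; ring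
    · refine ⟨- (((i : ℝ) + 1 - c i) / N) + (((i + 1) % N : ℕ) : ℝ) / N, ?_⟩
      rw [bb_odd, bb_even']
      intro x hx
      rw [modelMap_B hN (by omega) c (hc1 i).le hx.1 hx.2]; ring

theorem modelMap_hasRoot {N h : ℕ} (hN : 0 < N) (hh : 0 < h) (hhN : h ≤ N) (c : ℕ → ℝ)
    (hc : ∀ i, h ≤ i → c i = 0)
    (hind : ∀ (q : ℚ) (f : ℕ → ℚ), (q : ℝ) + ∑ l ∈ Finset.range h, (f l : ℝ) * c l = 0 →
      q = 0 ∧ ∀ l < h, f l = 0) :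
    Irrational (∑ l ∈ Finset.range N, c l) ∧ HasNontrivialRoot (modelMap N c) := by
  have hsum : ∑ l ∈ Finset.range N, c l = ∑ l ∈ Finset.range h, c l := by
    symm
    apply Finset.sum_subset
    · intro l hl; simp at hl ⊢; omega
    · intro l _ hl; exact hc l (by simpa using hl)
  constructor
  · rintro ⟨q, hq⟩
    have := (hind (-q) (fun _ => 1) (by
      push_cast; simp only [one_mul]; rw [← hsum, ← hq]; ring)).2 0 hh
    norm_num at this
  · refine ⟨_, N + 1, modelMap_isIET hN _ ?_, by omega, modelMap_root hN c⟩
    intro k hk h0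
    set z := ⌊c k - (∑ l ∈ Finset.range N, c l) / (N + 1)⌋ with hz
    have h1 : c k - (∑ l ∈ Finset.range N, c l) / (N + 1) = z := by
      have := Int.floor_add_fract (c k - (∑ l ∈ Finset.range N, c l) / (N + 1))
      rw [h0] at this
      linarith
    have h2 : ∑ l ∈ Finset.range h, ((if l = k then (1:ℚ) else 0 : ℚ) : ℝ) * c l = c k := by
      by_cases hkh : k < h
      · rw [Finset.sum_eq_single k]
        · simp
        · intro l _ hl; simp [hl]
        · intro hl; exact absurd (Finset.mem_range.2 hkh) hl
      · rw [hc k (by omega)]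
        apply Finset.sum_eq_zero
        intro l hl
        have : l ≠ k := by rw [Finset.mem_range] at hl; omega
        simp [this]
    have h3 := (hind (-z) (fun l => (if l = k then 1 else 0) - 1 / (N + 1)) (by
      push_cast
      simp only [sub_mul, Finset.sum_sub_distrib, ← Finset.mul_sum]
      rw [h2, ← hsum, ← h1]
      ring)).2 0 hh
    have hNq : (0:ℚ) < N := by exact_mod_cast hN
    have h4 : (1:ℚ) / (N + 1) < 1 := by rw [div_lt_one (by linarith)]; linarith
    have h5 : (0:ℚ) < 1 / (N + 1) := by positivity
    split_ifs at h3 <;> linarith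

theorem core {m N h : ℕ} (hm : 2 ≤ m) (hN : N = (m + 1) / 2) (hh : h = m / 2) (c : ℕ → ℝ)
    (hc01 : ∀ i < h, 0 < c i ∧ c i < 1) (hc : ∀ i, h ≤ i → c i = 0)
    (hind : ∀ (q : ℚ) (f : ℕ → ℚ), (q : ℝ) + ∑ l ∈ Finset.range h, (f l : ℝ) * c l = 0 →
      q = 0 ∧ ∀ l < h, f l = 0)
    (p : ℕ → ℕ) (b' : ℕ → ℝ) (hp : ∀ j < m, p j < m)
    (hpinj : ∀ i < m, ∀ j < m, p i = p j → i = j)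
    (hsep : ∀ j, j + 1 < m → p (j + 1) ≠ p j + 1)
    (h0' : b' 0 = 0)
    (hA : ∀ i < N, b' (p (2 * i)) = ((((i + 1) % N : ℕ) : ℝ) + c i) / N)
    (hA' : ∀ i < N, b' (p (2 * i) + 1) = ((((i + 1) % N : ℕ) : ℝ) + 1) / N)
    (hB : ∀ i < h, b' (p (2 * i + 1)) = (((i + 1) % N : ℕ) : ℝ) / N)
    (hB' : ∀ i < h, b' (p (2 * i + 1) + 1) = ((((i + 1) % N : ℕ) : ℝ) + c i) / N) :
    ∃ (π : Equiv.Perm (Fin m)) (lam : Fin m → ℝ),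
      Separating π ∧ (∀ i, 0 < lam i) ∧ (∑ i, lam i = 1) ∧
      IsMinimal (ietMap π lam) ∧
      ietRank (ietMap π lam) = 1 + m / 2 ∧
      HasNontrivialRoot (ietMap π lam) := by
  have hN0 : 0 < N := by omega
  have hN' : (0:ℝ) < N := by exact_mod_cast hN0
  have hc0 : ∀ i, 0 ≤ c i := fun i => by
    by_cases hi : i < h
    · exact (hc01 i hi).1.le
    · rw [hc i (by omega)]
  have hc1 : ∀ i, c i < 1 := fun i => by
    by_cases hi : i < h
    · exact (hc01 i hi).2
    · rw [hc i (by omega)]; norm_num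
  set b := bb N c with hbdef
  have hb : ∀ j < m, b j < b (j + 1) := by
    intro j hj
    rcases Nat.even_or_odd' j with ⟨i, rfl | rfl⟩
    · rw [hbdef, bb_even, bb_odd]; gcongr; linarith [hc1 i]
    · rw [hbdef, bb_odd, bb_even']; gcongr; linarith [hc01 i (by omega)]
  have h0 : b 0 = 0 := by simpa using bb_even N c 0
  have h1 : b m = 1 := by
    rcases Nat.even_or_odd' m with ⟨i, hi | hi⟩
    · have : N = i := by omega
      rw [hi, hbdef, bb_even, ← this]; field_simp
    · have : N = i + 1 := by omega
      rw [hi, hbdef, bb_odd, hc i (by omega), this]; push_cast; field_simp; simp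
  have hlen : ∀ j < m, b (j + 1) - b j = b' (p j + 1) - b' (p j) := by
    intro j hj
    rcases Nat.even_or_odd' j with ⟨i, rfl | rfl⟩
    · rw [hA i (by omega), hA' i (by omega), hbdef, bb_even, bb_odd]; ring
    · rw [hB i (by omega), hB' i (by omega), hbdef, bb_odd, bb_even']; ring
  let pf : Fin m → Fin m := fun j => ⟨p j, hp j j.2⟩
  have hinj : Function.Injective pf := by
    intro i j hij
    exact Fin.ext (hpinj i i.2 j j.2 (congrArg Fin.val hij))
  let π : Equiv.Perm (Fin m) := Equiv.ofBijective pf (Finite.injective_iff_bijective.1 hinj)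
  have hπ : ∀ j, (π j : ℕ) = p j := fun j => rfl
  let lam : Fin m → ℝ := fun j => b ((j : ℕ) + 1) - b j
  have hb' : ∀ k < m, b' k < b' (k + 1) := by
    intro k hk
    have h2 : (π (π.symm ⟨k, hk⟩) : ℕ) = k := by simp
    rw [hπ] at h2
    have h3 := hlen _ (π.symm ⟨k, hk⟩).2
    have h4 := hb _ (π.symm ⟨k, hk⟩).2
    rw [h2] at h3
    linarith
  have hT : ∀ j < m, ∀ x ∈ Set.Ico (b j) (b (j + 1)), ietMap π lam x = x - b j + b' (p j) :=
    fun j hj x hx => ietMap_apply π lam b b' hb h0 h0' (fun _ => rfl)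
      (fun j => hlen j j.2) ⟨j, hj⟩ x hx
  have hM : ietMap π lam = modelMap N c := by
    funext x
    by_cases hx : x ∈ unitI
    · obtain ⟨j, hj, hxj⟩ := locate (m := m) (b := b) (x := x) (by rw [h0]; exact hx.1)
        (by rw [h1]; exact hx.2)
      rw [hT j hj x hxj]
      rcases Nat.even_or_odd' j with ⟨i, rfl | rfl⟩
      · rw [hA i (by omega)]
        rw [hbdef, bb_even, bb_odd] at hxj
        rw [hbdef, bb_even, modelMap_A hN0 (by omega) c (hc0 i) hxj.1 hxj.2]
      · rw [hB i (by omega)]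
        rw [hbdef, bb_odd, bb_even'] at hxj
        rw [hbdef, bb_odd, modelMap_B hN0 (by omega) c (hc1 i).le hxj.1 hxj.2]
    · rw [ietMap_outside π lam b hb h0 h1 (fun _ => rfl) x hx]
      unfold modelMap; rw [if_neg hx]
  obtain ⟨hirr, hroot⟩ := modelMap_hasRoot hN0 (by omega : 0 < h) (by omega) c hc hind
  refine ⟨π, lam, ?_, fun j => sub_pos.2 (hb j j.2), ?_, ?_, ?_, ?_⟩
  · intro i j hij
    rw [hπ, hπ, hij]
    exact hsep i (by omega)
  · have : ∑ j : Fin m, lam j = ∑ j ∈ Finset.range m, (b (j + 1) - b j) :=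
      Fin.sum_univ_eq_sum_range (fun j => b (j + 1) - b j) m
    rw [this, Finset.sum_range_sub, h1, h0, sub_zero]
  · rw [hM]; exact modelMap_minimal hN0 c hirr
  · have hG := gapLengths_eq (by omega) (ietMap π lam) b hb h0 h1
      (discSet_eq _ b b' p hb h0 h1 hb' hp hlen hsep hT)
    unfold ietRank
    let w : Fin (h + 1) → ℝ := Fin.cons 1 (fun i : Fin h => c i)
    have hw : LinearIndependent ℚ w := by
      rw [Fintype.linearIndependent_iff]
      intro g hg
      rw [Fin.sum_univ_succ] at hg
      have h2 := hind (g 0) (fun l => if hl : l < h then g (Fin.succ ⟨l, hl⟩) else 0) (by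
        rw [← Fin.sum_univ_eq_sum_range
          (fun l => ((if hl : l < h then g (Fin.succ ⟨l, hl⟩) else 0 : ℚ) : ℝ) * c l) h]
        simpa [w, Rat.smul_def] using hg)
      intro i
      refine Fin.cases h2.1 (fun i => ?_) i
      simpa using h2.2 i i.2
    have hspan : Submodule.span ℚ (gapLengths (ietMap π lam)) =
        Submodule.span ℚ (Set.range w) := by
      rw [hG]
      apply le_antisymm
      · rw [Submodule.span_le]
        have hone : (1:ℝ) ∈ Submodule.span ℚ (Set.range w) :=
          Submodule.subset_span ⟨0, rfl⟩
        have hci : ∀ i, c i ∈ Submodule.span ℚ (Set.range w) := by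
          intro i
          by_cases hi : i < h
          · exact Submodule.subset_span ⟨Fin.succ ⟨i, hi⟩, rfl⟩
          · rw [hc i (by omega)]; exact Submodule.zero_mem _
        rintro _ ⟨j, hj, rfl⟩
        rcases Nat.even_or_odd' j with ⟨i, rfl | rfl⟩
        · have h2 : b (2 * i + 1) - b (2 * i) = ((1:ℚ) / N) • (1 - c i) := by
            rw [hbdef, bb_even, bb_odd, Rat.smul_def]; push_cast; ring
          rw [h2]
          exact Submodule.smul_mem _ _ (Submodule.sub_mem _ hone (hci i))
        · have h2 : b (2 * i + 1 + 1) - b (2 * i + 1) = ((1:ℚ) / N) • (c i) := by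
            rw [hbdef, bb_even', bb_odd, Rat.smul_def]; push_cast; ring
          rw [h2]
          exact Submodule.smul_mem _ _ (hci i)
      · rw [Submodule.span_le]
        rintro _ ⟨i, rfl⟩
        refine Fin.cases ?_ (fun i => ?_) i
        · have h2 : w 0 = ∑ j ∈ Finset.range m, (b (j + 1) - b j) := by
            rw [Finset.sum_range_sub, h1, h0, sub_zero]; rfl
          rw [h2]
          exact Submodule.sum_mem _ (fun j hj =>
            Submodule.subset_span ⟨j, Finset.mem_range.1 hj, rfl⟩)
        · have h2 : w i.succ = (N:ℚ) • (b (2 * (i : ℕ) + 1 + 1) - b (2 * (i : ℕ) + 1)) := by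
            rw [hbdef, bb_even', bb_odd, Rat.smul_def]
            simp only [w, Fin.cons_succ]
            push_cast; field_simp; ring
          rw [h2]
          exact Submodule.smul_mem _ _ (Submodule.subset_span ⟨_, by omega, rfl⟩)
    rw [hspan, finrank_span_eq_card hw, Fintype.card_fin]
    omega
  · rw [hM]; exact hroot

theorem succ_mod_cases {i N : ℕ} (hi : i < N) :
    (i + 1 < N ∧ (i + 1) % N = i + 1) ∨ (i + 1 = N ∧ (i + 1) % N = 0) := by
  rcases Nat.lt_or_ge (i + 1) N with h | h
  · exact Or.inl ⟨h, Nat.mod_eq_of_lt h⟩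
  · have : i + 1 = N := by omega
    exact Or.inr ⟨this, by rw [this]; simp⟩

/-- The permutation used for an even number of intervals. -/
def pEven (m j : ℕ) : ℕ :=
  if j % 2 = 0 then (if j + 2 < m then j + 3 else 1) else (if j + 1 < m then j + 1 else 0)

/-- The permutation used for an odd number of intervals. -/
def pOdd (m j : ℕ) : ℕ :=
  if j % 2 = 0 then (if j + 1 < m then j + 2 else 0) else j

/-- Cyclic predecessor of a block. -/
def prv (N t : ℕ) : ℕ := if t = 0 then N - 1 else t - 1

theorem prv_succ {i N : ℕ} (hi : i < N) : prv N ((i + 1) % N) = i := by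
  unfold prv
  rcases succ_mod_cases hi with ⟨h1, h2⟩ | ⟨h1, h2⟩ <;> rw [h2]
  · simp
  · simp; omega

/-- Image cut points, even case. -/
noncomputable def bEven (N : ℕ) (c : ℕ → ℝ) (k : ℕ) : ℝ :=
  if k % 2 = 0 then ((k / 2 : ℕ) : ℝ) / N else (((k / 2 : ℕ) : ℝ) + c (prv N (k / 2))) / N

/-- Image cut points, odd case. -/
noncomputable def bOdd (N : ℕ) (c : ℕ → ℝ) (k : ℕ) : ℝ :=
  if k % 2 = 0 then (((k / 2 : ℕ) : ℝ) + c (prv N (k / 2))) / N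
  else (((k / 2 : ℕ) : ℝ) + 1) / N

theorem bEven_even (N : ℕ) (c : ℕ → ℝ) {k s : ℕ} (hk : k = 2 * s) : bEven N c k = (s:ℝ) / N := by
  subst hk; unfold bEven; simp

theorem bEven_odd (N : ℕ) (c : ℕ → ℝ) {k s : ℕ} (hk : k = 2 * s + 1) :
    bEven N c k = ((s:ℝ) + c (prv N s)) / N := by
  have h1 : k / 2 = s := by omega
  have h2 : ¬ k % 2 = 0 := by omega
  unfold bEven; rw [if_neg h2, h1]

theorem bOdd_even (N : ℕ) (c : ℕ → ℝ) {k s : ℕ} (hk : k = 2 * s) :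
    bOdd N c k = ((s:ℝ) + c (prv N s)) / N := by
  have h1 : k / 2 = s := by omega
  have h2 : k % 2 = 0 := by omega
  unfold bOdd; rw [if_pos h2, h1]

theorem bOdd_odd (N : ℕ) (c : ℕ → ℝ) {k s : ℕ} (hk : k = 2 * s + 1) :
    bOdd N c k = ((s:ℝ) + 1) / N := by
  have h1 : k / 2 = s := by omega
  have h2 : ¬ k % 2 = 0 := by omega
  unfold bOdd; rw [if_neg h2, h1]

theorem stmt9 (m : ℕ) (hm : 2 ≤ m) :
    ∃ (π : Equiv.Perm (Fin m)) (lam : Fin m → ℝ),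
      Separating π ∧ (∀ i, 0 < lam i) ∧ (∑ i, lam i = 1) ∧
      IsMinimal (ietMap π lam) ∧
      ietRank (ietMap π lam) = 1 + m / 2 ∧
      HasNontrivialRoot (ietMap π lam) := by
  obtain ⟨c, hc01, hc, hind⟩ := exists_indep (m / 2)
  rcases Nat.even_or_odd' m with ⟨M, hM | hM⟩
  · -- even number of intervals
    have hN : (m + 1) / 2 = M := by omega
    have hh : m / 2 = M := by omega
    have e1 : ∀ i < M, pEven m (2 * i) = 2 * ((i + 1) % M) + 1 := by
      intro i hi
      unfold pEven
      rcases succ_mod_cases hi with ⟨h1, h2⟩ | ⟨h1, h2⟩ <;> rw [h2] <;> split_ifs <;> omega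
    have e2 : ∀ i < M, pEven m (2 * i + 1) = 2 * ((i + 1) % M) := by
      intro i hi
      unfold pEven
      rcases succ_mod_cases hi with ⟨h1, h2⟩ | ⟨h1, h2⟩ <;> rw [h2] <;> split_ifs <;> omega
    refine core hm rfl rfl c hc01 hc hind (pEven m) (bEven M c) ?_ ?_ ?_ ?_ ?_ ?_ ?_ ?_
    · intro j hj; unfold pEven; split_ifs <;> omega
    · intro i hi j hj hij; unfold pEven at hij; split_ifs at hij <;> omega
    · intro j hj; unfold pEven; split_ifs <;> omega
    · rw [bEven_even M c (s := 0) rfl]; simp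
    · intro i hi
      rw [hN] at hi ⊢
      rw [bEven_odd M c (e1 i hi), prv_succ hi]
    · intro i hi
      rw [hN] at hi ⊢
      rw [bEven_even M c (s := (i + 1) % M + 1) (by rw [e1 i hi]; ring)]
      push_cast; rfl
    · intro i hi
      rw [hh] at hi
      rw [hN, bEven_even M c (e2 i hi)]
    · intro i hi
      rw [hh] at hi
      rw [hN, bEven_odd M c (s := (i + 1) % M) (by rw [e2 i hi]), prv_succ hi]
  · -- odd number of intervals
    have hN : (m + 1) / 2 = M + 1 := by omega
    have hh : m / 2 = M := by omega
    have e1 : ∀ i < M + 1, pOdd m (2 * i) = 2 * ((i + 1) % (M + 1)) := by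
      intro i hi
      unfold pOdd
      rcases succ_mod_cases hi with ⟨h1, h2⟩ | ⟨h1, h2⟩ <;> rw [h2] <;> split_ifs <;> omega
    have e2 : ∀ i < M, pOdd m (2 * i + 1) = 2 * i + 1 := by
      intro i hi
      unfold pOdd
      split_ifs <;> omega
    have e3 : ∀ i < M, (i + 1) % (M + 1) = i + 1 := fun i hi => Nat.mod_eq_of_lt (by omega)
    refine core hm rfl rfl c hc01 hc hind (pOdd m) (bOdd (M + 1) c) ?_ ?_ ?_ ?_ ?_ ?_ ?_ ?_
    · intro j hj; unfold pOdd; split_ifs <;> omega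
    · intro i hi j hj hij; unfold pOdd at hij; split_ifs at hij <;> omega
    · intro j hj; unfold pOdd; split_ifs <;> omega
    · rw [bOdd_even (M + 1) c (s := 0) rfl]
      have : c (prv (M + 1) 0) = 0 := hc _ (by unfold prv; simp; omega)
      rw [this]; simp
    · intro i hi
      rw [hN] at hi ⊢
      rw [bOdd_even (M + 1) c (e1 i hi), prv_succ hi]
    · intro i hi
      rw [hN] at hi ⊢
      rw [bOdd_odd (M + 1) c (s := (i + 1) % (M + 1)) (by rw [e1 i hi])]
    · intro i hi
      rw [hh] at hi
      rw [hN, bOdd_odd (M + 1) c (e2 i hi), e3 i hi]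
      push_cast; rfl
    · intro i hi
      rw [hh] at hi
      rw [hN, bOdd_even (M + 1) c (s := (i + 1) % (M + 1)) (by rw [e2 i hi, e3 i hi]; ring),
        prv_succ (by omega)]

end IETRoots
end
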